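/- arXiv:1901.03976 — 5 statements merged into one kernel-verified Lean document; each statement's English description precedes it below -/
import Mathlib

section
/- Let d ≥ 1, let m > 2 be an integer, let H : ℝ^d → ℝ be a homogeneous polynomial of degree m, and let f be a real-valued function defined on a neighborhood of 0 in ℝ^d with f(x) = ‖x‖² + H(x) + o(‖x‖^m) as x → 0. Let X be a map from a neighborhood V of 0 in ℝ^d to ℝ^d with X(0) = 0, X differentiable at 0 with dX₀ = id (so X(u) = u + o(‖u‖)), and f(X(u)) = ‖u‖² for all u ∈ V. Then ‖X(u)‖² = ‖u‖² − H(u) + o(‖u‖^m) as u → 0. -/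
noncomputable section
open Filter Asymptotics
open scoped Topology

/-- `H : ℝ^d → ℝ` is (given by) a homogeneous polynomial of degree `m`. -/
def IsHomogPoly (d m : ℕ) (H : EuclideanSpace ℝ (Fin d) → ℝ) : Prop :=
  ∃ p : MvPolynomial (Fin d) ℝ, p.IsHomogeneous m ∧
    ∀ x, H x = MvPolynomial.eval (fun i => x i) p

theorem IsHomogPoly.continuous {d m : ℕ} {H : EuclideanSpace ℝ (Fin d) → ℝ}
    (hH : IsHomogPoly d m H) : Continuous H := by
  obtain ⟨p, -, hp⟩ := hH
  rw [funext hp]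
  exact (MvPolynomial.continuous_eval p).comp (by fun_prop)

theorem IsHomogPoly.map_smul {d m : ℕ} {H : EuclideanSpace ℝ (Fin d) → ℝ}
    (hH : IsHomogPoly d m H) (r : ℝ) (x : EuclideanSpace ℝ (Fin d)) :
    H (r • x) = r ^ m * H x := by
  obtain ⟨p, hpm, hp⟩ := hH
  rw [hp, hp, MvPolynomial.eval_eq', MvPolynomial.eval_eq', Finset.mul_sum]
  refine Finset.sum_congr rfl fun s hs => ?_
  have hdeg : ∑ i, s i = m := by
    rw [← hpm (MvPolynomial.mem_support_iff.mp hs), Finsupp.weight_apply,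
      Finsupp.sum_fintype _ _ (by simp)]
    simp
  simp only [PiLp.smul_apply, smul_eq_mul, mul_pow, Finset.prod_mul_distrib,
    Finset.prod_pow_eq_pow_sum, hdeg]
  ring

/-- A continuous positively homogeneous function on a proper normed space changes by
`o(‖u‖ ^ m)` when its argument `u` is perturbed by `o(‖u‖)`. -/
theorem isLittleO_comp_sub_of_homogeneous {E : Type*} [NormedAddCommGroup E] [NormedSpace ℝ E]
    [ProperSpace E] {m : ℕ} {H : E → ℝ} (hc : Continuous H)
    (hs : ∀ (r : ℝ) (x : E), H (r • x) = r ^ m * H x) {X : E → E} {l : Filter E}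
    (hX : (fun u => X u - u) =o[l] fun u => u) :
    (fun u => H (X u) - H u) =o[l] fun u => ‖u‖ ^ m := by
  refine isLittleO_iff.mpr fun ε hε => ?_
  obtain ⟨δ, hδ, hu⟩ := Metric.uniformContinuousOn_iff.mp
    ((isCompact_closedBall (0 : E) 2).uniformContinuousOn_of_continuous hc.continuousOn) ε hε
  have hη : 0 < min 1 (δ / 2) := by positivity
  filter_upwards [isLittleO_iff.mp hX hη] with u hXu
  rcases eq_or_ne u 0 with rfl | hu0
  · have h0 : X 0 = 0 := by simpa using hXu
    simp only [h0, sub_self, norm_zero]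
    positivity
  have hr : 0 < ‖u‖ := norm_pos_iff.mpr hu0
  set y := ‖u‖⁻¹ • X u with hy
  set z := ‖u‖⁻¹ • u with hz
  have hz1 : ‖z‖ = 1 := by
    rw [hz, norm_smul, norm_inv, norm_norm, inv_mul_cancel₀ hr.ne']
  have hyz : ‖y - z‖ ≤ min 1 (δ / 2) := by
    rw [hy, hz, ← smul_sub, norm_smul, norm_inv, norm_norm, inv_mul_le_iff₀ hr, mul_comm]
    exact hXu
  have hy2 : ‖y‖ ≤ 2 := by
    have h := norm_le_norm_add_norm_sub' y z
    have h' := hyz.trans (min_le_left _ _)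
    linarith
  have hlt := hu y (by simpa using hy2) z (by simp [hz1])
    (by rw [dist_eq_norm]; exact (hyz.trans (min_le_right _ _)).trans_lt (by linarith))
  have hXy : X u = ‖u‖ • y := by rw [hy, smul_inv_smul₀ hr.ne']
  have huz : H u = ‖u‖ ^ m * H z := by rw [← hs, hz, smul_inv_smul₀ hr.ne']
  rw [huz, hXy, hs, ← mul_sub, norm_mul, mul_comm]
  rw [Real.dist_eq] at hlt
  rw [norm_pow, norm_norm]
  gcongr
  exact hlt.le

/-- If `f(x) = ‖x‖² + H(x) + o(‖x‖^m)` with `H` a homogeneous polynomial of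
degree `m > 2`, and `X` is a map with `X(0) = 0`, `dX₀ = id`, defined near `0` with
`f(X(u)) = ‖u‖²`, then `‖X(u)‖² = ‖u‖² - H(u) + o(‖u‖^m)` as `u → 0`. -/
theorem statement10 (d : ℕ) (hd : 1 ≤ d) (m : ℕ) (hm : 2 < m)
    (H : EuclideanSpace ℝ (Fin d) → ℝ) (hH : IsHomogPoly d m H)
    (f : EuclideanSpace ℝ (Fin d) → ℝ)
    (hf : (fun x => f x - (‖x‖ ^ 2 + H x)) =o[𝓝 (0 : EuclideanSpace ℝ (Fin d))]
      fun x => ‖x‖ ^ m)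
    (X : EuclideanSpace ℝ (Fin d) → EuclideanSpace ℝ (Fin d))
    (V : Set (EuclideanSpace ℝ (Fin d))) (hV : V ∈ 𝓝 (0 : EuclideanSpace ℝ (Fin d)))
    (hX0 : X 0 = 0)
    (hdX : HasFDerivAt X (ContinuousLinearMap.id ℝ (EuclideanSpace ℝ (Fin d))) 0)
    (hfX : ∀ u ∈ V, f (X u) = ‖u‖ ^ 2) :
    (fun u => ‖X u‖ ^ 2 - (‖u‖ ^ 2 - H u)) =o[𝓝 (0 : EuclideanSpace ℝ (Fin d))]
      fun u => ‖u‖ ^ m := by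
  have hd0 : (fun u => X u - u) =o[𝓝 0] fun u => u := by
    simpa [hX0] using hdX.isLittleO
  have hH' := isLittleO_comp_sub_of_homogeneous hH.continuous hH.map_smul hd0
  have hXO : X =O[𝓝 0] fun u => u := by
    simpa using hd0.isBigO.add (isBigO_refl (fun u => u) (𝓝 0))
  have hXt : Tendsto X (𝓝 0) (𝓝 0) := by
    simpa [hX0] using hdX.continuousAt.tendsto
  have hfo := (hf.comp_tendsto hXt).trans_isBigO (hXO.norm_norm.pow m)
  refine (hfo.add hH').neg_left.congr' ?_ EventuallyEq.rfl
  filter_upwards [hV] with u hu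
  simp only [Function.comp_apply, hfX u hu]
  ring
end
end

section
/- Let d ≥ 1 and let f be real analytic on a neighborhood of 0 in ℝ^d with f(0) = 0, df₀ = 0, and second-order Taylor polynomial ‖x‖² at 0 (i.e. f(x) = ‖x‖² + o(‖x‖²) as x → 0). Then there exist open neighborhoods V, W of 0 in ℝ^d and a real analytic diffeomorphism X : V → W with X(0) = 0, dX₀ = id, and f(X(u)) = ‖u‖² for all u ∈ V (a normalized real-analytic Morse lemma). -/
noncomputable section
open Filter Asymptotics
open scoped Topology

theorem FormalMultilinearSeries.unshift_shift_self {𝕜 E F : Type*} [NontriviallyNormedField 𝕜]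
    [NormedAddCommGroup E] [NormedSpace 𝕜 E] [NormedAddCommGroup F] [NormedSpace 𝕜 F]
    (p : FormalMultilinearSeries 𝕜 E F) : p.shift.unshift (p 0 0) = p := by
  ext n v
  cases n with
  | zero => simp [FormalMultilinearSeries.unshift, Subsingleton.elim v 0]
  | succ n => simp [FormalMultilinearSeries.unshift, FormalMultilinearSeries.shift]

/-- Hadamard's lemma for analytic functions. -/
theorem AnalyticAt.exists_eventually_eq_add_apply_sub {𝕜 E F : Type*} [NontriviallyNormedField 𝕜]
    [NormedAddCommGroup E] [NormedSpace 𝕜 E] [NormedAddCommGroup F] [NormedSpace 𝕜 F]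
    [CompleteSpace F] {f : E → F} {x : E} (hf : AnalyticAt 𝕜 f x) :
    ∃ g : E → E →L[𝕜] F, AnalyticAt 𝕜 g x ∧ ∀ᶠ y in 𝓝 x, f y = f x + g y (y - x) := by
  obtain ⟨p, r, hp⟩ := hf
  have hr : r ≤ p.shift.radius := p.radius_shift.symm ▸ hp.r_le
  have hg := ((p.shift.hasFPowerSeriesOnBall (hp.r_pos.trans_le hr)).mono hp.r_pos hr).comp_sub x
  rw [zero_add] at hg
  refine ⟨_, hg.analyticAt, ?_⟩
  have hu := hg.unshift (z := p 0 0)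
  rw [p.unshift_shift_self] at hu
  filter_upwards [Metric.eball_mem_nhds x hp.r_pos] with y hy
  rw [hp.unique hu hy]
  simp only [← hp.coeff_zero 0]

/-- Analytic inverse function theorem. -/
theorem HasStrictFDerivAt.analyticAt_localInverse {𝕜 E F : Type*} [NontriviallyNormedField 𝕜]
    [NormedAddCommGroup E] [NormedSpace 𝕜 E] [NormedAddCommGroup F] [NormedSpace 𝕜 F]
    [CompleteSpace E] {f : E → F} {f' : E ≃L[𝕜] F} {x : E}
    (hf : HasStrictFDerivAt f (f' : E →L[𝕜] F) x) (hfa : AnalyticAt 𝕜 f x) :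
    AnalyticAt 𝕜 (hf.localInverse f f' x) (f x) :=
  (hf.toOpenPartialHomeomorph f).analyticAt_symm' hf.mem_toOpenPartialHomeomorph_source hfa
    hf.hasFDerivAt.fderiv

/-- Near `1`, self-adjoint elements of a Banach algebra with continuous involution have self-adjoint
square roots depending analytically on the element. -/
theorem exists_analyticAt_sqrt_isSelfAdjoint {A : Type*} [NormedRing A] [NormedAlgebra ℝ A]
    [CompleteSpace A] [StarRing A] [ContinuousStar A] :
    ∃ R : A → A, AnalyticAt ℝ R 1 ∧ R 1 = 1 ∧
      ∀ᶠ a in 𝓝 1, R a * R a = a ∧ (IsSelfAdjoint a → IsSelfAdjoint (R a)) := by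
  have han : AnalyticAt ℝ (fun a : A => a * a) 1 := analyticAt_id.mul analyticAt_id
  have hd : HasStrictFDerivAt (fun a : A => a * a)
      ((ContinuousLinearEquiv.smulLeft (Units.mk0 (2 : ℝ) two_ne_zero) : A ≃L[ℝ] A) : A →L[ℝ] A)
      1 := by
    refine ((hasStrictFDerivAt_id (𝕜 := ℝ) (1 : A)).mul' (hasStrictFDerivAt_id 1)).congr_fderiv ?_
    ext1 a
    simp [two_smul, Units.smul_def]
  have hR := hd.analyticAt_localInverse han
  have hR1 := hd.localInverse_apply_image
  have hr := hd.eventually_right_inverse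
  have hl := hd.eventually_left_inverse
  simp only [mul_one] at hR hR1 hr
  refine ⟨_, hR, hR1, ?_⟩
  have hc := hR.continuousAt
  rw [ContinuousAt, hR1] at hc
  have hs : Tendsto (fun a : A => star a) (𝓝 1) (𝓝 1) := by
    simpa using (continuous_star (R := A)).tendsto 1
  filter_upwards [hr, (hs.comp hc).eventually hl] with a ha h2
  refine ⟨ha, fun hsa => ?_⟩
  simp only [Function.comp_apply] at h2
  rw [← star_mul, ha, hsa.star_eq] at h2
  exact h2.symm

/-- A bilinear form on a real Hilbert space has the same diagonal as a self-adjoint operator, which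
can be chosen to depend linearly and continuously on the form. -/
theorem exists_clm_isSelfAdjoint_inner_eq {E : Type*} [NormedAddCommGroup E]
    [InnerProductSpace ℝ E] [CompleteSpace E] :
    ∃ T : (E →L[ℝ] E →L[ℝ] ℝ) →L[ℝ] (E →L[ℝ] E),
      ∀ B, IsSelfAdjoint (T B) ∧ ∀ v, inner ℝ (T B v) v = B v v := by
  let J : (E →L[ℝ] ℝ) →L[ℝ] E :=
    (InnerProductSpace.toDual ℝ E).symm.toContinuousLinearEquiv.toContinuousLinearMap
  have hJ (l : E →L[ℝ] ℝ) (v : E) : inner ℝ (J l) v = l v :=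
    InnerProductSpace.toDual_symm_apply
  let C := ContinuousLinearMap.compL ℝ E (E →L[ℝ] ℝ) E J
  let K := ContinuousLinearMap.flipₗᵢ ℝ E E ℝ
  refine ⟨(2⁻¹ : ℝ) • (C + C.comp K.toContinuousLinearEquiv.toContinuousLinearMap),
    fun B => ⟨?_, ?_⟩⟩
  · rw [ContinuousLinearMap.isSelfAdjoint_iff_isSymmetric]
    intro v w
    simp [C, K, inner_add_left, inner_add_right, inner_smul_left, inner_smul_right, hJ,
      real_inner_comm (J _) v, add_comm]
  · intro v
    simp [C, K, inner_add_left, inner_smul_left, hJ]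
    ring

/-- A quadratic form which is `o(‖x‖ ^ 2)` at `0` vanishes. -/
theorem apply_self_eq_zero_of_isLittleO {E : Type*} [NormedAddCommGroup E] [NormedSpace ℝ E]
    {q : E → ℝ} (hq : ∀ (t : ℝ) v, q (t • v) = t ^ 2 * q v)
    (ho : q =o[𝓝 0] fun x => ‖x‖ ^ 2) (v : E) : q v = 0 := by
  have ht : Tendsto (fun t : ℝ => t • v) (𝓝[≠] 0) (𝓝 0) := by
    have : Tendsto (fun t : ℝ => t • v) (𝓝 0) (𝓝 ((0 : ℝ) • v)) :=
      (continuous_id.smul continuous_const).tendsto 0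
    rw [zero_smul] at this
    exact this.mono_left nhdsWithin_le_nhds
  have hb : ((fun x => ‖x‖ ^ 2) ∘ fun t : ℝ => t • v) =O[𝓝[≠] 0] fun t : ℝ => t ^ 2 := by
    refine .of_bound (‖v‖ ^ 2) (.of_forall fun t => ?_)
    simp [norm_smul, mul_pow, mul_comm]
  have h0 := ((ho.comp_tendsto ht).trans_isBigO hb).tendsto_div_nhds_zero
  have hc : (fun t : ℝ => (q ∘ fun t : ℝ => t • v) t / t ^ 2) =ᶠ[𝓝[≠] 0] fun _ => q v := by
    filter_upwards [self_mem_nhdsWithin] with t (h : t ≠ 0)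
    simp only [Function.comp_apply, hq]
    field_simp
  exact tendsto_nhds_unique (tendsto_const_nhds.congr' hc.symm) h0

/-- An analytic function `f x = ‖x‖ ^ 2 + o(‖x‖ ^ 2)` can be written near `0` as
`⟪A x x, x⟫` with `A` analytic, self-adjoint, and `A 0 = 1`. -/
theorem AnalyticAt.exists_isSelfAdjoint_inner_eq {E : Type*} [NormedAddCommGroup E]
    [InnerProductSpace ℝ E] [CompleteSpace E] {f : E → ℝ} (hf : AnalyticAt ℝ f 0)
    (hf0 : f 0 = 0) (hdf : fderiv ℝ f 0 = 0)
    (ho : (fun x => f x - ‖x‖ ^ 2) =o[𝓝 0] fun x => ‖x‖ ^ 2) :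
    ∃ A : E → (E →L[ℝ] E), AnalyticAt ℝ A 0 ∧ A 0 = 1 ∧ (∀ x, IsSelfAdjoint (A x)) ∧
      ∀ᶠ x in 𝓝 0, f x = inner ℝ (A x x) x := by
  obtain ⟨g, hg, hfg⟩ := hf.exists_eventually_eq_add_apply_sub
  simp only [hf0, zero_add, sub_zero] at hfg
  have hg0 : g 0 = 0 := by
    have h1 : HasFDerivAt (fun x => g x x) (g 0) 0 :=
      (hg.differentiableAt.hasFDerivAt.clm_apply (hasFDerivAt_id 0)).congr_fderiv (by ext; simp)
    rw [← hdf, (h1.congr_of_eventuallyEq hfg).fderiv]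
  obtain ⟨h, hh, hgh⟩ := hg.exists_eventually_eq_add_apply_sub
  simp only [hg0, zero_add, sub_zero] at hgh
  obtain ⟨T, hT⟩ := exists_clm_isSelfAdjoint_inner_eq (E := E)
  have hA : AnalyticAt ℝ (fun x => T (h x)) 0 :=
    AnalyticAt.comp (g := T) (T.analyticAt (h 0)) hh
  have hfA : ∀ᶠ x in 𝓝 0, f x = inner ℝ (T (h x) x) x := by
    filter_upwards [hfg, hgh] with x h1 h2
    rw [h1, h2, (hT _).2]
  refine ⟨_, hA, ?_, fun x => (hT _).1, hfA⟩
  have hsa : IsSelfAdjoint (T (h 0) - 1) := (hT (h 0)).1.sub (.one _)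
  rw [← sub_eq_zero]
  have hsym := ContinuousLinearMap.isSelfAdjoint_iff_isSymmetric.1 hsa
  have hdiag := hsym.inner_map_self_eq_zero.1 fun v => by
    refine apply_self_eq_zero_of_isLittleO (q := fun v => inner ℝ ((T (h 0) - 1) v) v) ?_ ?_ v
    · intro t v
      simp only [map_smul, inner_smul_left, inner_smul_right, conj_trivial]
      ring
    · have hlim : Tendsto (fun x => ‖T (h 0) - T (h x)‖) (𝓝 0) (𝓝 0) := by
        simpa using
          ((continuousAt_const (y := T (h 0))).sub hA.continuousAt).norm.tendsto
      have hlit : (fun x => inner ℝ ((T (h 0) - T (h x)) x) x) =o[𝓝 0] fun x => ‖x‖ ^ 2 := by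
        refine IsBigO.trans_isLittleO
          (g := fun x => ‖T (h 0) - T (h x)‖ * ‖x‖ ^ 2) ?_ ?_
        · refine .of_bound 1 (.of_forall fun x => ?_)
          rw [one_mul, norm_mul, norm_norm, norm_pow, norm_norm, pow_two, ← mul_assoc]
          exact (norm_inner_le_norm _ _).trans (by gcongr; exact ContinuousLinearMap.le_opNorm _ _)
        · simpa using ((isLittleO_one_iff ℝ).2 hlim).mul_isBigO
            (isBigO_refl (fun x : E => ‖x‖ ^ 2) (𝓝 0))
      refine (hlit.add ho).congr' ?_ .rfl
      filter_upwards [hfA] with x hx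
      simp only [hx, sub_apply, one_apply_eq_self, inner_sub_left,
        real_inner_self_eq_norm_sq]
      ring
  ext v
  exact congrArg (fun L : E →ₗ[ℝ] E => L v) hdiag

/-- An analytic function `f x = ‖x‖ ^ 2 + o(‖x‖ ^ 2)` is, near `0`, the squared norm of an analytic
map tangent to the identity. -/
theorem AnalyticAt.exists_eventually_eq_norm_sq {E : Type*} [NormedAddCommGroup E]
    [InnerProductSpace ℝ E] [CompleteSpace E] {f : E → ℝ} (hf : AnalyticAt ℝ f 0)
    (hf0 : f 0 = 0) (hdf : fderiv ℝ f 0 = 0)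
    (ho : (fun x => f x - ‖x‖ ^ 2) =o[𝓝 0] fun x => ‖x‖ ^ 2) :
    ∃ Y : E → E, AnalyticAt ℝ Y 0 ∧ Y 0 = 0 ∧
      HasStrictFDerivAt Y (ContinuousLinearMap.id ℝ E) 0 ∧ ∀ᶠ x in 𝓝 0, f x = ‖Y x‖ ^ 2 := by
  obtain ⟨A, hA, hA0, hAsa, hfA⟩ := hf.exists_isSelfAdjoint_inner_eq hf0 hdf ho
  obtain ⟨R, hR, hR1, hRR⟩ := exists_analyticAt_sqrt_isSelfAdjoint (A := E →L[ℝ] E)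
  have hRA : AnalyticAt ℝ (fun x => R (A x)) 0 := hR.comp_of_eq hA hA0
  have hAc := hA.continuousAt.tendsto
  rw [hA0] at hAc
  refine ⟨fun x => R (A x) x, ?_, by simp, ?_, ?_⟩
  · exact ((ContinuousLinearMap.id ℝ (E →L[ℝ] E)).analyticAt_bilinear (R (A 0), 0)).comp₂
      hRA analyticAt_id
  · refine (hRA.hasStrictFDerivAt.clm_apply (hasStrictFDerivAt_id 0)).congr_fderiv ?_
    ext
    simp [hA0, hR1]
  · filter_upwards [hfA, hAc.eventually hRR] with x hx hx2
    have hs := ContinuousLinearMap.isSelfAdjoint_iff_isSymmetric.1 (hx2.2 (hAsa x))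
    rw [hx, ← real_inner_self_eq_norm_sq]
    conv_lhs => rw [← hx2.1]
    exact hs _ _

/-- normalized real-analytic Morse lemma. If `f` is real analytic near `0`
with `f(0) = 0`, `df₀ = 0` and second-order Taylor polynomial `‖x‖²` at `0`, then there are
open neighborhoods `V, W` of `0` and a real analytic diffeomorphism `X : V → W` with
`X(0) = 0`, `dX₀ = id` and `f(X(u)) = ‖u‖²` on `V`. -/
theorem statement11 (d : ℕ) (hd : 1 ≤ d)
    (f : EuclideanSpace ℝ (Fin d) → ℝ)
    (W₀ : Set (EuclideanSpace ℝ (Fin d))) (hW₀ : W₀ ∈ 𝓝 (0 : EuclideanSpace ℝ (Fin d)))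
    (hf_an : AnalyticOnNhd ℝ f W₀)
    (hf0 : f 0 = 0) (hdf0 : fderiv ℝ f 0 = 0)
    (hTaylor : (fun x => f x - ‖x‖ ^ 2) =o[𝓝 (0 : EuclideanSpace ℝ (Fin d))]
      fun x => ‖x‖ ^ 2) :
    ∃ V W : Set (EuclideanSpace ℝ (Fin d)), IsOpen V ∧ IsOpen W ∧
      (0 : EuclideanSpace ℝ (Fin d)) ∈ V ∧ (0 : EuclideanSpace ℝ (Fin d)) ∈ W ∧
      ∃ X : EuclideanSpace ℝ (Fin d) → EuclideanSpace ℝ (Fin d),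
        X 0 = 0 ∧
        HasFDerivAt X (ContinuousLinearMap.id ℝ (EuclideanSpace ℝ (Fin d))) 0 ∧
        Set.BijOn X V W ∧ AnalyticOnNhd ℝ X V ∧
        (∃ Y : EuclideanSpace ℝ (Fin d) → EuclideanSpace ℝ (Fin d),
          Set.BijOn Y W V ∧ (∀ u ∈ V, Y (X u) = u) ∧ (∀ w ∈ W, X (Y w) = w) ∧
          AnalyticOnNhd ℝ Y W) ∧
        ∀ u ∈ V, f (X u) = ‖u‖ ^ 2 := by
  obtain ⟨Y, hYa, hY0, hYd, hfY⟩ :=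
    (hf_an 0 (mem_of_mem_nhds hW₀)).exists_eventually_eq_norm_sq hf0 hdf0 hTaylor
  have hd' : HasStrictFDerivAt Y ((ContinuousLinearEquiv.refl ℝ (EuclideanSpace ℝ (Fin d)) :
      EuclideanSpace ℝ (Fin d) →L[ℝ] EuclideanSpace ℝ (Fin d))) 0 := hYd
  have hXa := hd'.analyticAt_localInverse hYa
  have hXd := hd'.to_localInverse.hasFDerivAt
  have hX0 := hd'.localInverse_apply_image
  rw [hY0] at hXa hXd hX0
  obtain ⟨O, hO, hOo, h0O⟩ := eventually_nhds_iff.1 (hfY.and hYa.eventually_analyticAt)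
  obtain ⟨U, hU, hUo, h0U⟩ := eventually_nhds_iff.1 hXa.eventually_analyticAt
  let e := ((hd'.toOpenPartialHomeomorph Y).restrOpen O hOo).symm.restrOpen U hUo
  have h0t : (0 : EuclideanSpace ℝ (Fin d)) ∈ (hd'.toOpenPartialHomeomorph Y).target := by
    have := hd'.image_mem_toOpenPartialHomeomorph_target
    rwa [hY0] at this
  have h0V : (0 : EuclideanSpace ℝ (Fin d)) ∈ e.source :=
    ⟨⟨h0t, Set.mem_preimage.2 (hX0.symm ▸ h0O : hd'.localInverse Y _ 0 0 ∈ O)⟩, h0U⟩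
  have heO {w} (hw : w ∈ e.target) : w ∈ O := hw.1.2
  have heX : e = hd'.localInverse Y _ 0 := rfl
  have heY : e.symm = Y := rfl
  refine ⟨e.source, e.target, e.open_source, e.open_target, h0V, ?_, e, hX0, hXd, e.bijOn,
    fun u hu => hU u hu.2, ⟨Y, e.symm.bijOn, fun u hu => e.left_inv hu,
      fun w hw => e.right_inv hw, fun w hw => (hO w (heO hw)).2⟩, fun u hu => ?_⟩
  · have := e.map_source h0V
    rwa [heX, hX0] at this
  · rw [(hO _ (heO (e.map_source hu))).1, ← heY, e.left_inv hu]
end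
end

section
/- Let d ≥ 2, let m > 4 and α ≥ 1 be integers, put k = 2α + 1, and let H : ℝ^d → ℝ be a homogeneous polynomial of degree m. Let p, q : ℝ^d → ℂ be C^∞ with compact support such that p(u) = H(u)^k + o(‖u‖^{km}) and q(u) = (2α+1)·H(u)^{k−1} + o(‖u‖^{(k−1)m}) as u → 0. Then there is a constant C ≠ 0, depending only on d, m, α (and not on H, p, q), such that iμ ∫_{ℝ^d} e^{iμ‖u‖²} p(u) du + ∫_{ℝ^d} e^{iμ‖u‖²} q(u) du = C · (Δ^{mα}(H^{2α}))(0) · μ^{−mα−d/2} + o(μ^{−mα−d/2}) as μ → +∞. -/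
noncomputable section
open MeasureTheory Filter Asymptotics
open scoped Topology

/-- The Laplace operator `Δ = Σ ∂²/∂u_j²` on functions on `ℝ^d`. -/
def lap (d : ℕ) (g : EuclideanSpace ℝ (Fin d) → ℝ) (x : EuclideanSpace ℝ (Fin d)) : ℝ :=
  ∑ i, iteratedFDeriv ℝ 2 g x ![EuclideanSpace.single i 1, EuclideanSpace.single i 1]

section StationaryPhase

open FourierTransform SchwartzMap
open scoped Laplacian

theorem exists_norm_exp_sub_sum_le (n : ℕ) : ∃ K : ℝ, 0 ≤ K ∧ ∀ z : ℂ, z.re ≤ 0 →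
    ‖Complex.exp z - ∑ j ∈ Finset.range n, z ^ j / (j.factorial : ℂ)‖ ≤ K * ‖z‖ ^ n := by
  refine ⟨Real.exp 1 + (1 + n), by positivity, fun z hz => ?_⟩
  rw [add_mul]
  rcases le_total ‖z‖ 1 with h | h
  · refine (Complex.norm_exp_sub_sum_le_norm_mul_exp z n).trans ?_
    have h1 : Real.exp ‖z‖ ≤ Real.exp 1 := Real.exp_le_exp.2 h
    have h2 : 0 ≤ ‖z‖ ^ n := by positivity
    have h3 : 0 ≤ (1 + (n : ℝ)) * ‖z‖ ^ n := by positivity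
    nlinarith
  · have h1 : ‖Complex.exp z‖ ≤ 1 := by
      rw [Complex.norm_exp]; exact Real.exp_le_one_iff.2 hz
    have h2 : (1 : ℝ) ≤ ‖z‖ ^ n := one_le_pow₀ h
    have h3 : ‖∑ j ∈ Finset.range n, z ^ j / (j.factorial : ℂ)‖ ≤ n * ‖z‖ ^ n := by
      refine (norm_sum_le_of_le (Finset.range n) (f := fun j => z ^ j / (j.factorial : ℂ))
        (n := fun _ => ‖z‖ ^ n) fun j hj => ?_).trans (by simp)
      rw [norm_div, norm_pow, Complex.norm_natCast]
      have : (1 : ℝ) ≤ j.factorial := by exact_mod_cast j.factorial_pos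
      refine (div_le_self (by positivity) this).trans ?_
      exact pow_le_pow_right₀ h (Finset.mem_range.1 hj).le
    have h4 := norm_sub_le (Complex.exp z) (∑ j ∈ Finset.range n, z ^ j / (j.factorial : ℂ))
    have h5 : 0 ≤ Real.exp 1 * ‖z‖ ^ n := by positivity
    linarith

theorem re_neg_pi_sq_mul_div_nonpos {b : ℂ} (hb : 0 ≤ b.re) (r : ℝ) :
    (-Real.pi ^ 2 * r ^ 2 / b : ℂ).re ≤ 0 := by
  have : (-Real.pi ^ 2 * r ^ 2 / b : ℂ) = ((-(Real.pi ^ 2 * r ^ 2) : ℝ) : ℂ) * b⁻¹ := by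
    push_cast; ring
  rw [this, Complex.re_ofReal_mul, Complex.inv_re]
  exact mul_nonpos_of_nonpos_of_nonneg (by simp; positivity)
    (div_nonneg hb (Complex.normSq_nonneg _))

theorem isBigO_norm_pow_of_le {E : Type*} [NormedAddCommGroup E] {m n : ℕ} (h : m ≤ n) :
    (fun u : E => ‖u‖ ^ n) =O[𝓝 0] fun u : E => ‖u‖ ^ m := by
  refine IsBigO.of_bound 1 ?_
  filter_upwards [Metric.closedBall_mem_nhds (0 : E) one_pos] with u hu
  rw [mem_closedBall_zero_iff] at hu
  simpa using pow_le_pow_of_le_one (norm_nonneg u) hu h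

theorem exists_norm_le_mul_norm_pow {V : Type*} [NormedAddCommGroup V] [NormedSpace ℝ V] {n : ℕ}
    (f : 𝓢(V, ℂ))
    (hf : f =O[𝓝 0] fun u : V => ‖u‖ ^ n) :
    ∃ C : ℝ, 0 ≤ C ∧ ∀ u, ‖f u‖ ≤ C * ‖u‖ ^ n := by
  obtain ⟨C, hC0, hC⟩ := hf.exists_pos
  obtain ⟨δ, hδ, hball⟩ := Metric.eventually_nhds_iff.1 hC.bound
  obtain ⟨M, hM⟩ : ∃ M, ∀ u, ‖f u‖ ≤ M := by
    obtain ⟨M, -, hM⟩ := f.decay 0 0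
    exact ⟨M, fun u => by simpa using hM u⟩
  have hM0 : 0 ≤ M := (norm_nonneg _).trans (hM 0)
  refine ⟨C + M / δ ^ n, by positivity, fun u => ?_⟩
  rw [add_mul]
  rcases lt_or_ge ‖u‖ δ with h | h
  · have h1 := hball (y := u) (by simpa using h)
    have h2 : 0 ≤ M / δ ^ n * ‖u‖ ^ n := by positivity
    rw [norm_pow, norm_norm] at h1
    linarith
  · have h1 : M ≤ M / δ ^ n * ‖u‖ ^ n := by
      rw [div_mul_eq_mul_div, le_div_iff₀ (by positivity)]
      gcongr
    have h2 : 0 ≤ C * ‖u‖ ^ n := by positivity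
    linarith [hM u]

section Gaussian

variable {V : Type*} [NormedAddCommGroup V] [InnerProductSpace ℝ V] [FiniteDimensional ℝ V]
  [MeasurableSpace V] [BorelSpace V]

theorem integral_gaussian_mul_of_re_pos {b : ℂ} (hb : 0 < b.re) (f : 𝓢(V, ℂ)) :
    ∫ u : V, Complex.exp (-b * ‖u‖ ^ 2) * f u
      = (Real.pi / b) ^ (Module.finrank ℝ V / 2 : ℂ) *
        ∫ w : V, Complex.exp (-Real.pi ^ 2 * ‖w‖ ^ 2 / b) * (𝓕⁻ f) w := by
  have hg : Integrable fun u : V => Complex.exp (-b * ‖u‖ ^ 2) := by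
    simpa using GaussianFourier.integrable_cexp_neg_mul_sq_norm_add hb 0 (0 : V)
  have key := VectorFourier.integral_fourierIntegral_smul_eq_flip (μ := (volume : Measure V))
    (ν := (volume : Measure V)) (L := innerₗ V) Real.continuous_fourierChar
    (by exact continuous_inner) hg (𝓕⁻ f).integrable
  have h1 : ∀ w : V, VectorFourier.fourierIntegral Real.fourierChar volume (innerₗ V)
      (fun u : V => Complex.exp (-b * ‖u‖ ^ 2)) w = 𝓕 (fun u : V => Complex.exp (-b * ‖u‖ ^ 2)) w :=
    fun w => rfl
  have h2 : ∀ u : V, VectorFourier.fourierIntegral Real.fourierChar volume (innerₗ V).flip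
      (⇑(𝓕⁻ f : 𝓢(V, ℂ))) u = f u := by
    intro u
    rw [flip_innerₗ]
    change (𝓕 (⇑(𝓕⁻ f : 𝓢(V, ℂ)))) u = f u
    rw [← SchwartzMap.fourier_coe, FourierTransform.fourier_fourierInv_eq]
  simp only [h1, h2, fourier_gaussian_innerProductSpace hb, smul_eq_mul, mul_assoc] at key
  rw [← integral_const_mul]
  exact key.symm

theorem integral_gaussian_mul {b : ℂ} (hb : 0 ≤ b.re) (hb0 : b ≠ 0) (f : 𝓢(V, ℂ)) :
    ∫ u : V, Complex.exp (-b * ‖u‖ ^ 2) * f u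
      = (Real.pi / b) ^ (Module.finrank ℝ V / 2 : ℂ) *
        ∫ w : V, Complex.exp (-Real.pi ^ 2 * ‖w‖ ^ 2 / b) * (𝓕⁻ f) w := by
  have hre : ∀ ε : ℝ, 0 < ε → 0 < (b + ε).re := fun ε hε => by simp; linarith
  have hc : Tendsto (fun ε : ℝ => b + ε) (𝓝[>] 0) (𝓝 b) := by
    have : Continuous fun ε : ℝ => b + ε := by fun_prop
    simpa using (this.tendsto 0).mono_left nhdsWithin_le_nhds
  have hL : Tendsto (fun ε : ℝ => ∫ u : V, Complex.exp (-(b + ε) * ‖u‖ ^ 2) * f u) (𝓝[>] 0)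
      (𝓝 (∫ u : V, Complex.exp (-b * ‖u‖ ^ 2) * f u)) := by
    refine tendsto_integral_filter_of_dominated_convergence (fun u => ‖f u‖)
      (Eventually.of_forall fun ε => ?_) ?_ f.integrable.norm (ae_of_all _ fun u => ?_)
    · exact (by fun_prop : Continuous _).aestronglyMeasurable
    · filter_upwards [self_mem_nhdsWithin] with ε hε
      refine ae_of_all _ fun u => ?_
      rw [norm_mul, Complex.norm_exp, ← Complex.ofReal_pow, Complex.re_mul_ofReal, Complex.neg_re]
      refine mul_le_of_le_one_left (norm_nonneg _) (Real.exp_le_one_iff.2 ?_)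
      nlinarith [sq_nonneg ‖u‖, hre ε hε]
    · have : Continuous fun c : ℂ => Complex.exp (-c * ‖u‖ ^ 2) * f u := by fun_prop
      exact (this.tendsto b).comp hc
  have hR : Tendsto (fun ε : ℝ => ∫ w : V, Complex.exp (-Real.pi ^ 2 * ‖w‖ ^ 2 / (b + ε)) *
      (𝓕⁻ f) w) (𝓝[>] 0)
      (𝓝 (∫ w : V, Complex.exp (-Real.pi ^ 2 * ‖w‖ ^ 2 / b) * (𝓕⁻ f) w)) := by
    refine tendsto_integral_filter_of_dominated_convergence (fun u => ‖(𝓕⁻ f) u‖)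
      (Eventually.of_forall fun ε => ?_) ?_ (𝓕⁻ f).integrable.norm (ae_of_all _ fun u => ?_)
    · exact (by fun_prop : Continuous _).aestronglyMeasurable
    · filter_upwards [self_mem_nhdsWithin] with ε hε
      refine ae_of_all _ fun u => ?_
      rw [norm_mul]
      refine mul_le_of_le_one_left (norm_nonneg _) ?_
      rw [Complex.norm_exp]
      exact Real.exp_le_one_iff.2 (re_neg_pi_sq_mul_div_nonpos (hre ε hε).le _)
    · have : ContinuousAt (fun c : ℂ => Complex.exp (-Real.pi ^ 2 * ‖u‖ ^ 2 / c) * (𝓕⁻ f) u) b := by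
        fun_prop (disch := assumption)
      exact this.tendsto.comp hc
  have hP : Tendsto (fun ε : ℝ => ((Real.pi : ℂ) / (b + ε)) ^ (Module.finrank ℝ V / 2 : ℂ)) (𝓝[>] 0)
      (𝓝 ((Real.pi / b) ^ (Module.finrank ℝ V / 2 : ℂ))) := by
    have hs : (Real.pi : ℂ) / b ∈ Complex.slitPlane := by
      rw [div_eq_mul_inv, Complex.mem_slitPlane_iff, Complex.re_ofReal_mul, Complex.im_ofReal_mul,
        Complex.inv_re, Complex.inv_im]
      have hn : 0 < Complex.normSq b := Complex.normSq_pos.2 hb0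
      rcases hb.lt_or_eq with h | h
      · exact Or.inl (mul_pos Real.pi_pos (div_pos h hn))
      · have : b.im ≠ 0 := fun h' => hb0 (Complex.ext h.symm h')
        exact Or.inr (mul_ne_zero Real.pi_ne_zero (div_ne_zero (neg_ne_zero.2 this) hn.ne'))
    have : ContinuousAt (fun c : ℂ => ((Real.pi : ℂ) / c) ^ (Module.finrank ℝ V / 2 : ℂ)) b := by
      refine ContinuousAt.cpow ?_ continuousAt_const hs
      fun_prop (disch := assumption)
    exact this.tendsto.comp hc
  refine tendsto_nhds_unique hL ((hP.mul hR).congr' ?_)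
  filter_upwards [self_mem_nhdsWithin] with ε hε
  exact (integral_gaussian_mul_of_re_pos (hre ε hε) f).symm

theorem fourierInv_laplacian_apply (f : 𝓢(V, ℂ)) (w : V) :
    (𝓕⁻ (Δ f) : 𝓢(V, ℂ)) w = (-(4 * Real.pi ^ 2 * ‖w‖ ^ 2) : ℂ) * (𝓕⁻ f : 𝓢(V, ℂ)) w := by
  have h : (𝓕 (Δ f) : 𝓢(V, ℂ)) (-w)
      = (-(4 * Real.pi ^ 2 * ‖w‖ ^ 2) : ℂ) * (𝓕 f : 𝓢(V, ℂ)) (-w) := by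
    rw [laplacian_eq_fourierMultiplierCLM, FourierTransform.fourier_smul,
      SchwartzMap.fourierMultiplierCLM_apply, FourierTransform.fourier_fourierInv_eq]
    rw [smul_apply, SchwartzMap.smulLeftCLM_apply_apply (by fun_prop)]
    simp
    ring
  simpa [SchwartzMap.fourierInv_apply_eq] using h

theorem fourierInv_laplacian_iterate_apply (j : ℕ) (f : 𝓢(V, ℂ)) (w : V) :
    (𝓕⁻ (Δ^[j] f) : 𝓢(V, ℂ)) w
      = (-(4 * Real.pi ^ 2 * ‖w‖ ^ 2) : ℂ) ^ j * (𝓕⁻ f : 𝓢(V, ℂ)) w := by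
  induction j with
  | zero => simp
  | succ j ih =>
    rw [Function.iterate_succ_apply', fourierInv_laplacian_apply, ih]
    ring

theorem laplacian_iterate_apply_zero (j : ℕ) (f : 𝓢(V, ℂ)) :
    (Δ^[j] f : 𝓢(V, ℂ)) 0
      = ∫ w : V, (-(4 * Real.pi ^ 2 * ‖w‖ ^ 2) : ℂ) ^ j * (𝓕⁻ f : 𝓢(V, ℂ)) w := by
  simp_rw [← fourierInv_laplacian_iterate_apply]
  conv_lhs => rw [← FourierTransform.fourier_fourierInv_eq (F := 𝓢(V, ℂ)) (Δ^[j] f)]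
  rw [SchwartzMap.fourier_coe, Real.fourier_eq]
  simp

theorem integrable_norm_pow_mul_schwartz (j : ℕ) (f : 𝓢(V, ℂ)) :
    Integrable fun w : V => (-(4 * Real.pi ^ 2 * ‖w‖ ^ 2) : ℂ) ^ j * (𝓕⁻ f : 𝓢(V, ℂ)) w := by
  simp_rw [← fourierInv_laplacian_iterate_apply]
  exact SchwartzMap.integrable _

/-- Asymptotic expansion of Gaussian integrals, uniformly in the closed right half plane. -/
theorem exists_norm_integral_gaussian_mul_sub_le (n : ℕ) (f : 𝓢(V, ℂ)) :
    ∃ K : ℝ, 0 ≤ K ∧ ∀ b : ℂ, 0 ≤ b.re → b ≠ 0 →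
      ‖(∫ u : V, Complex.exp (-b * ‖u‖ ^ 2) * f u)
        - (Real.pi / b) ^ (Module.finrank ℝ V / 2 : ℂ) *
          ∑ j ∈ Finset.range n, (4 * b)⁻¹ ^ j / (j.factorial : ℂ) * (Δ^[j] f : 𝓢(V, ℂ)) 0‖
      ≤ ‖((Real.pi : ℂ) / b) ^ (Module.finrank ℝ V / 2 : ℂ)‖ * (K * (‖b‖⁻¹) ^ n) := by
  obtain ⟨K, hK0, hK⟩ := exists_norm_exp_sub_sum_le n
  set g : 𝓢(V, ℂ) := 𝓕⁻ f with hg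
  refine ⟨∫ w : V, K * 4⁻¹ ^ n * ‖(-(4 * Real.pi ^ 2 * ‖w‖ ^ 2) : ℂ) ^ n * g w‖,
    by positivity, fun b hb hb0 => ?_⟩
  have hs : ∀ (w : V) (j : ℕ), (-Real.pi ^ 2 * ‖w‖ ^ 2 / b : ℂ) ^ j
      = (4 * b)⁻¹ ^ j * (-(4 * Real.pi ^ 2 * ‖w‖ ^ 2) : ℂ) ^ j := fun w j => by
    rw [← mul_pow]; congr 1; field_simp
  have hint : ∀ j : ℕ, Integrable fun w : V =>
      (4 * b)⁻¹ ^ j / (j.factorial : ℂ) * ((-(4 * Real.pi ^ 2 * ‖w‖ ^ 2) : ℂ) ^ j * g w) :=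
    fun j => (integrable_norm_pow_mul_schwartz j f).const_mul _
  have hE : Integrable fun w : V => Complex.exp (-Real.pi ^ 2 * ‖w‖ ^ 2 / b) * g w := by
    refine g.integrable.bdd_mul (c := 1) (by fun_prop) (ae_of_all _ fun w => ?_)
    rw [Complex.norm_exp]
    exact Real.exp_le_one_iff.2 (re_neg_pi_sq_mul_div_nonpos hb _)
  rw [integral_gaussian_mul hb hb0, ← mul_sub, norm_mul]
  refine mul_le_mul_of_nonneg_left ?_ (norm_nonneg _)
  simp_rw [laplacian_iterate_apply_zero, ← integral_const_mul]
  rw [← integral_finsetSum _ fun j _ => hint j, ← integral_sub hE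
    (integrable_finsetSum _ fun j _ => hint j),
    ← integral_mul_const]
  refine norm_integral_le_of_norm_le
    (((integrable_norm_pow_mul_schwartz n f).norm.const_mul _).mul_const _)
    (ae_of_all _ fun w => ?_)
  have h1 := hK (-Real.pi ^ 2 * ‖w‖ ^ 2 / b) (re_neg_pi_sq_mul_div_nonpos hb _)
  have h2 : (Complex.exp (-Real.pi ^ 2 * ‖w‖ ^ 2 / b) * g w -
      ∑ j ∈ Finset.range n, (4 * b)⁻¹ ^ j / (j.factorial : ℂ) *
        ((-(4 * Real.pi ^ 2 * ‖w‖ ^ 2) : ℂ) ^ j * g w))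
      = (Complex.exp (-Real.pi ^ 2 * ‖w‖ ^ 2 / b) -
        ∑ j ∈ Finset.range n, (-Real.pi ^ 2 * ‖w‖ ^ 2 / b : ℂ) ^ j / (j.factorial : ℂ)) * g w := by
    rw [sub_mul, Finset.sum_mul]
    congr 1
    refine Finset.sum_congr rfl fun j _ => ?_
    rw [hs]; ring
  rw [h2, norm_mul]
  refine (mul_le_mul_of_nonneg_right h1 (norm_nonneg _)).trans (le_of_eq ?_)
  rw [← norm_pow, hs, norm_mul, norm_mul, norm_pow (4 * b)⁻¹, norm_inv, norm_mul]
  simp only [RCLike.norm_ofNat, mul_inv, mul_pow]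
  ring

theorem integrable_norm_pow_mul_exp_neg_sq (N : ℕ) :
    Integrable fun v : V => ‖v‖ ^ (2 * N) * Real.exp (-‖v‖ ^ 2) := by
  have h0 : Integrable fun v : V => Real.exp (-(1 / 2) * ‖v‖ ^ 2) := by
    have := (GaussianFourier.integrable_cexp_neg_mul_sq_norm_add (V := V) (b := 1 / 2)
      (by norm_num) 0 0).norm
    refine this.congr (ae_of_all _ fun v => ?_)
    simp only [inner_zero_left, Complex.ofReal_zero, mul_zero, add_zero, Complex.norm_exp]
    rw [← Complex.ofReal_pow, Complex.re_mul_ofReal]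
    norm_num
  refine (h0.const_mul (2 ^ N * N.factorial)).mono' (by fun_prop) (ae_of_all _ fun v => ?_)
  have h := Real.pow_div_factorial_le_exp (‖v‖ ^ 2 / 2) (by positivity) N
  rw [div_le_iff₀ (by positivity), div_pow, div_le_iff₀ (by positivity), ← pow_mul] at h
  rw [Real.norm_of_nonneg (by positivity)]
  calc ‖v‖ ^ (2 * N) * Real.exp (-‖v‖ ^ 2)
      ≤ (Real.exp (‖v‖ ^ 2 / 2) * N.factorial * 2 ^ N) * Real.exp (-‖v‖ ^ 2) := by gcongr
    _ = 2 ^ N * N.factorial * (Real.exp (‖v‖ ^ 2 / 2) * Real.exp (-‖v‖ ^ 2)) := by ring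
    _ = _ := by rw [← Real.exp_add]; congr 2; ring

theorem tendsto_pow_mul_integral_gaussian_mul {N : ℕ} {f : 𝓢(V, ℂ)}
    (hf : f =o[𝓝 0] fun u : V => ‖u‖ ^ (2 * N)) :
    Tendsto (fun s : ℝ => ((s : ℂ) ^ (Module.finrank ℝ V + 2 * N)) *
      ∫ u : V, Complex.exp (-((s ^ 2 : ℝ) : ℂ) * ‖u‖ ^ 2) * f u) atTop (𝓝 0) := by
  obtain ⟨C, hC0, hC⟩ := exists_norm_le_mul_norm_pow f hf.isBigO
  have hlim : Tendsto (fun s : ℝ => ∫ v : V, Complex.exp (-‖v‖ ^ 2) *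
      ((s : ℂ) ^ (2 * N) * f (s⁻¹ • v))) atTop (𝓝 (∫ _ : V, (0 : ℂ))) := by
    refine tendsto_integral_filter_of_dominated_convergence
      (fun v => C * (‖v‖ ^ (2 * N) * Real.exp (-‖v‖ ^ 2)))
      (Eventually.of_forall fun s => ?_) ?_
      ((integrable_norm_pow_mul_exp_neg_sq N).const_mul C) (ae_of_all _ fun v => ?_)
    · have := f.continuous
      exact (by fun_prop : Continuous _).aestronglyMeasurable
    · filter_upwards [eventually_gt_atTop 0] with s hs
      refine ae_of_all _ fun v => ?_
      have h1 := hC (s⁻¹ • v)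
      rw [norm_smul, norm_inv, Real.norm_of_nonneg hs.le, mul_pow] at h1
      have h2 : ‖Complex.exp (-(‖v‖ : ℂ) ^ 2)‖ = Real.exp (-‖v‖ ^ 2) := by
        rw [Complex.norm_exp]; norm_cast
      rw [norm_mul, norm_mul, h2, norm_pow, Complex.norm_real, Real.norm_of_nonneg hs.le]
      calc Real.exp (-‖v‖ ^ 2) * (s ^ (2 * N) * ‖f (s⁻¹ • v)‖)
          ≤ Real.exp (-‖v‖ ^ 2) * (s ^ (2 * N) * (C * (s⁻¹ ^ (2 * N) * ‖v‖ ^ (2 * N)))) := by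
            gcongr
        _ = C * (‖v‖ ^ (2 * N) * Real.exp (-‖v‖ ^ 2)) := by rw [inv_pow]; field_simp
    · have h0 : Tendsto (fun s : ℝ => s⁻¹ • v) atTop (𝓝 0) := by
        simpa using (tendsto_inv_atTop_zero (𝕜 := ℝ)).smul_const v
      have h1 : (fun s : ℝ => f (s⁻¹ • v)) =o[atTop] fun s : ℝ => ‖s⁻¹ • v‖ ^ (2 * N) :=
        hf.comp_tendsto h0
      have h2 : (fun s : ℝ => Complex.exp (-‖v‖ ^ 2) * ((s : ℂ) ^ (2 * N) * f (s⁻¹ • v)))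
          =o[atTop] fun s : ℝ => s ^ (2 * N) * ‖s⁻¹ • v‖ ^ (2 * N) := by
        refine IsLittleO.const_mul_left ?_ _
        refine IsBigO.mul_isLittleO (IsBigO.of_bound 1 (Eventually.of_forall fun s => ?_)) h1
        simp
      refine (isLittleO_one_iff ℝ).1 (h2.trans_isBigO (IsBigO.of_bound (‖v‖ ^ (2 * N)) ?_))
      filter_upwards [eventually_gt_atTop 0] with s hs
      rw [norm_smul, norm_inv, Real.norm_of_nonneg hs.le, ← mul_pow, mul_inv_cancel_left₀ hs.ne']
      simp
  rw [integral_zero] at hlim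
  refine hlim.congr' ?_
  filter_upwards [eventually_gt_atTop 0] with s hs
  have h := Measure.integral_comp_smul (volume : Measure V)
    (fun u : V => Complex.exp (-((s ^ 2 : ℝ) : ℂ) * ‖u‖ ^ 2) * f u) s⁻¹
  rw [abs_of_nonneg (by positivity), inv_pow, inv_inv, Complex.real_smul] at h
  rw [pow_add, mul_right_comm, ← Complex.ofReal_pow s (Module.finrank ℝ V), ← h,
    ← integral_mul_const]
  refine integral_congr_ae (ae_of_all _ fun v => ?_)
  have hs' : (s : ℂ) ≠ 0 := by exact_mod_cast hs.ne'
  have : (-((s ^ 2 : ℝ) : ℂ) * ‖s⁻¹ • v‖ ^ 2 : ℂ) = -‖v‖ ^ 2 := by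
    rw [norm_smul, norm_inv, Real.norm_of_nonneg hs.le]
    push_cast
    field_simp
  simp only [this]
  ring

theorem laplacian_iterate_apply_zero_eq_zero {N : ℕ} {f : 𝓢(V, ℂ)}
    (hf : f =o[𝓝 0] fun u : V => ‖u‖ ^ (2 * N)) {j : ℕ} (hj : j ≤ N) :
    (Δ^[j] f : 𝓢(V, ℂ)) 0 = 0 := by
  induction j using Nat.strong_induction_on with
  | _ j ih =>
  set d := Module.finrank ℝ V with hd
  obtain ⟨K, hK0, hK⟩ := exists_norm_integral_gaussian_mul_sub_le (j + 1) f
  have hT := (tendsto_pow_mul_integral_gaussian_mul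
    (hf.trans_isBigO (isBigO_norm_pow_of_le (Nat.mul_le_mul_left 2 hj)))).norm
  set c : ℝ := Real.pi ^ (d / 2 : ℝ) with hc
  have hc0 : 0 < c := by positivity
  set a : ℂ := (Δ^[j] f : 𝓢(V, ℂ)) 0 with ha
  have hlim : Tendsto (fun s : ℝ => ‖(s : ℂ) ^ (d + 2 * j) *
      ∫ u : V, Complex.exp (-((s ^ 2 : ℝ) : ℂ) * ‖u‖ ^ 2) * f u‖ + c * K * (s⁻¹) ^ 2)
      atTop (𝓝 0) := by
    simpa using hT.add ((tendsto_inv_atTop_zero.pow 2).const_mul (c * K))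
  have hle : c * (4⁻¹ ^ j / j.factorial) * ‖a‖ ≤ 0 := by
    refine ge_of_tendsto hlim ?_
    filter_upwards [eventually_gt_atTop 0] with s hs
    have h := hK ((s ^ 2 : ℝ) : ℂ) (by simp only [Complex.ofReal_re]; positivity)
      (by exact_mod_cast (pow_pos hs 2).ne')
    rw [Finset.sum_range_succ, Finset.sum_eq_zero fun i hi => by
      rw [ih i (Finset.mem_range.1 hi) ((Finset.mem_range.1 hi).le.trans hj), mul_zero],
      zero_add] at h
    have hP : ‖((Real.pi : ℂ) / ((s ^ 2 : ℝ) : ℂ)) ^ (d / 2 : ℂ)‖ = c / s ^ d := by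
      rw [← Complex.ofReal_div, Complex.norm_cpow_eq_rpow_re_of_pos (by positivity)]
      have : ((d : ℂ) / 2).re = (d : ℝ) / 2 := by simp
      rw [this, Real.div_rpow Real.pi_pos.le (by positivity), ← Real.rpow_natCast_mul hs.le]
      congr 1
      rw [← Real.rpow_natCast]; congr 1; push_cast; ring
    have h1 := norm_sub_norm_le (((Real.pi : ℂ) / ((s ^ 2 : ℝ) : ℂ)) ^ (d / 2 : ℂ) *
      ((4 * ((s ^ 2 : ℝ) : ℂ))⁻¹ ^ j / (j.factorial : ℂ) * a))
      (∫ u : V, Complex.exp (-((s ^ 2 : ℝ) : ℂ) * ‖u‖ ^ 2) * f u)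
    rw [norm_sub_rev] at h1
    have h2 := h1.trans h
    rw [norm_mul, hP] at h2
    simp only [norm_mul, norm_div, norm_pow, norm_inv, Complex.norm_real, Complex.norm_natCast,
      Real.norm_of_nonneg hs.le, RCLike.norm_ofNat] at h2 ⊢
    have h3 := mul_le_mul_of_nonneg_left h2 (by positivity : 0 ≤ s ^ (d + 2 * j))
    rw [mul_sub, sub_le_iff_le_add] at h3
    refine le_trans (le_of_eq ?_) (h3.trans (le_of_eq ?_))
    · rw [mul_inv, mul_pow, pow_add, pow_mul, inv_pow (s ^ 2)]
      field_simp
    · rw [pow_add, pow_mul, inv_pow (s ^ 2), pow_succ (s ^ 2) j, inv_pow s]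
      field_simp
      ring
  have : ‖a‖ ≤ 0 := nonpos_of_mul_nonpos_right hle (by positivity)
  exact norm_le_zero_iff.1 this

/-- Leading term of the stationary phase expansion for an amplitude whose iterated Laplacians of
order less than `n` vanish at the critical point. -/
theorem isLittleO_integral_exp_mul_sub {n : ℕ} {f : 𝓢(V, ℂ)}
    (hf : ∀ j < n, (Δ^[j] f : 𝓢(V, ℂ)) 0 = 0) :
    (fun μ : ℝ => (∫ u : V, Complex.exp (Complex.I * μ * ‖u‖ ^ 2) * f u)
      - (Real.pi * Complex.I) ^ (Module.finrank ℝ V / 2 : ℂ) * (Complex.I / 4) ^ n / n.factorial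
        * (Δ^[n] f : 𝓢(V, ℂ)) 0 * ((μ ^ (-(n : ℝ) - Module.finrank ℝ V / 2) : ℝ) : ℂ))
      =o[atTop] fun μ : ℝ => μ ^ (-(n : ℝ) - Module.finrank ℝ V / 2) := by
  obtain ⟨K, hK0, hK⟩ := exists_norm_integral_gaussian_mul_sub_le (n + 1) f
  set d := Module.finrank ℝ V with hd
  set κ : ℂ := (Real.pi * Complex.I) ^ (d / 2 : ℂ) with hκ
  have hO : (fun μ : ℝ => (∫ u : V, Complex.exp (Complex.I * μ * ‖u‖ ^ 2) * f u)
      - κ * (Complex.I / 4) ^ n / n.factorial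
        * (Δ^[n] f : 𝓢(V, ℂ)) 0 * ((μ ^ (-(n : ℝ) - d / 2) : ℝ) : ℂ))
      =O[atTop] fun μ : ℝ => μ ^ (-(n : ℝ) - d / 2) * μ⁻¹ := by
    refine IsBigO.of_bound (‖κ‖ * K) ?_
    filter_upwards [eventually_gt_atTop 0] with μ hμ
    have hμ' : (μ : ℂ) ≠ 0 := by exact_mod_cast hμ.ne'
    have hP : ((Real.pi : ℂ) / (-(Complex.I * μ))) ^ (d / 2 : ℂ)
        = κ * ((μ ^ (-(d / 2) : ℝ) : ℝ) : ℂ) := by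
      have h0 : (Real.pi : ℂ) / (-(Complex.I * μ)) = (μ⁻¹ : ℝ) * (Real.pi * Complex.I) := by
        push_cast
        field_simp
        simp
      have hπ : (Real.pi : ℂ) * Complex.I ≠ 0 :=
        mul_ne_zero (by exact_mod_cast Real.pi_ne_zero) Complex.I_ne_zero
      rw [h0, hκ, Complex.cpow_def_of_ne_zero (mul_ne_zero (by simpa using hμ.ne') hπ),
        Complex.cpow_def_of_ne_zero hπ, Complex.log_ofReal_mul (inv_pos.2 hμ) hπ, add_mul,
        Complex.exp_add, mul_comm, Real.rpow_def_of_pos hμ, Complex.ofReal_exp, Real.log_inv]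
      push_cast
      ring_nf
    have h := hK (-(Complex.I * μ)) (by simp) (by simpa using hμ.ne')
    rw [Finset.sum_range_succ, Finset.sum_eq_zero fun i hi => by
      rw [hf i (Finset.mem_range.1 hi), mul_zero], zero_add, hP, norm_mul, neg_neg] at h
    have hn : μ ^ (-(n : ℝ) - d / 2) = μ ^ (-(d / 2) : ℝ) * μ⁻¹ ^ n := by
      rw [sub_eq_add_neg, add_comm, Real.rpow_add hμ, Real.rpow_neg hμ.le n, Real.rpow_natCast,
        inv_pow]
    have h4 : (4 * -(Complex.I * μ))⁻¹ ^ n = (Complex.I / 4) ^ n * ((μ⁻¹ ^ n : ℝ) : ℂ) := by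
      push_cast
      rw [← mul_pow]
      congr 1
      field_simp
      simp
    rw [h4] at h
    have hr : (0 : ℝ) ≤ μ ^ (-(d / 2) : ℝ) := by positivity
    rw [norm_mul, Real.norm_of_nonneg (by positivity), Real.norm_of_nonneg (by positivity)]
    convert h using 1
    · congr 2
      rw [hn]; push_cast; ring
    · rw [hn, Complex.norm_real, Real.norm_of_nonneg hr, norm_neg, norm_mul, Complex.norm_I,
        one_mul, Complex.norm_real, Real.norm_of_nonneg hμ.le]
      ring
  refine hO.trans_isLittleO ?_
  have h1 : (fun μ : ℝ => μ⁻¹) =o[atTop] fun _ : ℝ => (1 : ℝ) :=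
    (isLittleO_one_iff ℝ).2 tendsto_inv_atTop_zero
  simpa using (isBigO_refl (fun μ : ℝ => μ ^ (-(n : ℝ) - d / 2)) atTop).mul_isLittleO h1

theorem isBigO_integral_exp_mul {n : ℕ} {f : 𝓢(V, ℂ)}
    (hf : ∀ j < n, (Δ^[j] f : 𝓢(V, ℂ)) 0 = 0) :
    (fun μ : ℝ => ∫ u : V, Complex.exp (Complex.I * μ * ‖u‖ ^ 2) * f u)
      =O[atTop] fun μ : ℝ => μ ^ (-(n : ℝ) - Module.finrank ℝ V / 2) := by
  refine ((isLittleO_integral_exp_mul_sub hf).isBigO.add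
    (g := fun μ : ℝ => μ ^ (-(n : ℝ) - Module.finrank ℝ V / 2)) (f₂ := fun μ : ℝ =>
    (Real.pi * Complex.I) ^ (Module.finrank ℝ V / 2 : ℂ) * (Complex.I / 4) ^ n / n.factorial
        * (Δ^[n] f : 𝓢(V, ℂ)) 0 * ((μ ^ (-(n : ℝ) - Module.finrank ℝ V / 2) : ℝ) : ℂ))
    ?_).congr_left fun μ => sub_add_cancel _ _
  refine IsBigO.const_mul_left ?_ _
  exact IsBigO.of_bound 1 (Eventually.of_forall fun μ => by simp)

end Gaussian

theorem laplacian_iterate_sub_smul {V : Type*} [NormedAddCommGroup V]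
    [InnerProductSpace ℝ V] [FiniteDimensional ℝ V] (j : ℕ) (f g : 𝓢(V, ℂ)) (c : ℂ) :
    Δ^[j] (f - c • g) = Δ^[j] f - c • Δ^[j] g := by
  induction j with
  | zero => rfl
  | succ j ih =>
    rw [Function.iterate_succ_apply', ih, Function.iterate_succ_apply',
      Function.iterate_succ_apply',
      ← SchwartzMap.laplacianCLM_eq ℂ, ← SchwartzMap.laplacianCLM_eq ℂ,
      ← SchwartzMap.laplacianCLM_eq ℂ, map_sub, map_smul]

theorem isBigO_of_isHomogPoly {d m : ℕ} {H : EuclideanSpace ℝ (Fin d) → ℝ}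
    (hH : IsHomogPoly d m H) (l : Filter (EuclideanSpace ℝ (Fin d))) :
    H =O[l] fun u => ‖u‖ ^ m := by
  obtain ⟨p, hp, hHp⟩ := hH
  rw [funext hHp]
  simp_rw [MvPolynomial.eval_eq']
  refine IsBigO.fun_sum fun e he => ?_
  refine IsBigO.const_mul_left ?_ _
  refine IsBigO.of_bound 1 (Eventually.of_forall fun u => ?_)
  have hdeg : ∑ i, e i = m := by
    rw [← hp (MvPolynomial.mem_support_iff.1 he), Finsupp.weight_apply]
    simp [Finsupp.sum_fintype]
  rw [one_mul, norm_prod, ← hdeg, norm_pow, norm_norm, ← Finset.prod_pow_eq_pow_sum]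
  refine Finset.prod_le_prod (fun _ _ => norm_nonneg _) fun i _ => ?_
  rw [norm_pow]
  exact pow_le_pow_left₀ (norm_nonneg _) (PiLp.norm_apply_le u i) _

theorem contDiff_of_isHomogPoly {d m : ℕ} {H : EuclideanSpace ℝ (Fin d) → ℝ}
    (hH : IsHomogPoly d m H) : ContDiff ℝ (⊤ : ℕ∞) H := by
  obtain ⟨p, hp, hHp⟩ := hH
  rw [funext hHp]
  simp_rw [MvPolynomial.eval_eq']
  fun_prop

theorem lap_eq_laplacian {d : ℕ} (g : EuclideanSpace ℝ (Fin d) → ℝ) : lap d g = Δ g := by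
  rw [InnerProductSpace.laplacian_eq_iteratedFDeriv_orthonormalBasis g
    (EuclideanSpace.basisFun (Fin d) ℝ)]
  ext x
  simp [lap]

theorem contDiff_lap {d : ℕ} {g : EuclideanSpace ℝ (Fin d) → ℝ} (hg : ContDiff ℝ (⊤ : ℕ∞) g) :
    ContDiff ℝ (⊤ : ℕ∞) (lap d g) := by
  unfold lap
  refine ContDiff.sum fun i _ => ?_
  have h : ContDiff ℝ (⊤ : ℕ∞) (iteratedFDeriv ℝ 2 g) :=
    hg.iteratedFDeriv_right le_rfl
  exact (ContinuousMultilinearMap.apply ℝ (fun _ : Fin 2 => EuclideanSpace ℝ (Fin d)) ℝ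
    ![EuclideanSpace.single i 1, EuclideanSpace.single i 1]).contDiff.comp h

theorem laplacian_iterate_eventuallyEq {d : ℕ} {f : 𝓢(EuclideanSpace ℝ (Fin d), ℂ)}
    {g : EuclideanSpace ℝ (Fin d) → ℝ} (hg : ContDiff ℝ (⊤ : ℕ∞) g)
    {x : EuclideanSpace ℝ (Fin d)} (h : f =ᶠ[𝓝 x] fun u => (g u : ℂ)) (j : ℕ) :
    ContDiff ℝ (⊤ : ℕ∞) ((lap d)^[j] g) ∧
      (Δ^[j] f : 𝓢(EuclideanSpace ℝ (Fin d), ℂ)) =ᶠ[𝓝 x] fun u => (((lap d)^[j] g u : ℝ) : ℂ) := by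
  induction j with
  | zero => exact ⟨hg, h⟩
  | succ j ih =>
    obtain ⟨h1, h2⟩ := ih
    rw [Function.iterate_succ_apply', Function.iterate_succ_apply']
    refine ⟨contDiff_lap h1, ?_⟩
    have h3 := InnerProductSpace.laplacian_congr_nhds h2
    filter_upwards [h3] with u hu
    rw [SchwartzMap.laplacian_apply, hu, lap_eq_laplacian]
    exact (contDiff_infty.1 h1 2).contDiffAt.laplacian_CLM_comp_left
      (l := Complex.ofRealCLM)

theorem isLittleO_of_isLittleO_sub_pow {d m k n : ℕ} {H : EuclideanSpace ℝ (Fin d) → ℝ}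
    (hH : IsHomogPoly d m H) {f : EuclideanSpace ℝ (Fin d) → ℂ} {c : ℂ} (hn : n < k * m)
    (h : (fun u => f u - c * (H u : ℂ) ^ k) =o[𝓝 0] fun u => ‖u‖ ^ (k * m)) :
    f =o[𝓝 0] fun u => ‖u‖ ^ n := by
  have h1 : (fun u => c * (H u : ℂ) ^ k) =O[𝓝 0] fun u => ‖u‖ ^ (k * m) := by
    refine IsBigO.const_mul_left ?_ c
    have h2 : (fun u => (H u : ℂ)) =O[𝓝 0] fun u => ‖u‖ ^ m :=
      IsBigO.of_norm_left (by simpa using (isBigO_of_isHomogPoly hH (𝓝 0)).norm_left)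
    simpa [← pow_mul, mul_comm m k] using h2.pow k
  have h2 := h.isBigO.add h1
  simp only [sub_add_cancel] at h2
  exact h2.trans_isLittleO (isLittleO_norm_pow_norm_pow hn)

theorem laplacian_iterate_apply_zero_of_isLittleO_sub {d N : ℕ}
    {f : 𝓢(EuclideanSpace ℝ (Fin d), ℂ)} {g : EuclideanSpace ℝ (Fin d) → ℝ}
    (hg : ContDiff ℝ (⊤ : ℕ∞) g) {c : ℂ}
    (h : (fun u => f u - c * (g u : ℂ)) =o[𝓝 0] fun u => ‖u‖ ^ (2 * N)) :
    (Δ^[N] f : 𝓢(EuclideanSpace ℝ (Fin d), ℂ)) 0 = c * (((lap d)^[N] g 0 : ℝ) : ℂ) := by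
  let χ : ContDiffBump (0 : EuclideanSpace ℝ (Fin d)) := ⟨1, 2, one_pos, one_lt_two⟩
  have hχ : HasCompactSupport fun u => (((χ u * g u : ℝ)) : ℂ) :=
    (χ.hasCompactSupport.mul_right (f' := g)).comp_left Complex.ofReal_zero
  have hχ' : ContDiff ℝ (⊤ : ℕ∞) fun u => (((χ u * g u : ℝ)) : ℂ) :=
    Complex.ofRealCLM.contDiff.comp (χ.contDiff.mul hg)
  set S : 𝓢(EuclideanSpace ℝ (Fin d), ℂ) := hχ.toSchwartzMap hχ'
  have hS : S =ᶠ[𝓝 0] fun u => (g u : ℂ) := by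
    filter_upwards [χ.eventuallyEq_one] with u hu
    change (((χ u * g u : ℝ)) : ℂ) = _
    rw [hu]
    simp
  have h0 : (f - c • S : 𝓢(EuclideanSpace ℝ (Fin d), ℂ)) =o[𝓝 0] fun u => ‖u‖ ^ (2 * N) := by
    refine h.congr' ?_ EventuallyEq.rfl
    filter_upwards [hS] with u hu
    simp [hu]
  have h1 := laplacian_iterate_apply_zero_eq_zero h0 le_rfl
  rw [laplacian_iterate_sub_smul] at h1
  have h2 := (laplacian_iterate_eventuallyEq hg hS N).2.eq_of_nhds
  rw [← h2]
  simpa [sub_eq_zero] using h1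

end StationaryPhase

/-- Let `d ≥ 2`, `m > 4`, `α ≥ 1`, `k = 2α+1`. There is a constant `C ≠ 0`
depending only on `d, m, α` such that for every homogeneous polynomial `H` of degree `m` and
all smooth compactly supported `p, q` with `p(u) = H(u)^k + o(‖u‖^{km})` and
`q(u) = (2α+1)H(u)^{k-1} + o(‖u‖^{(k-1)m})` near `0`,
`iμ ∫ e^{iμ‖u‖²} p + ∫ e^{iμ‖u‖²} q = C (Δ^{mα} H^{2α})(0) μ^{-mα-d/2} + o(μ^{-mα-d/2})`
as `μ → +∞`. -/
theorem statement12 (d : ℕ) (hd : 2 ≤ d) (m α : ℕ) (hm : 4 < m) (hα : 1 ≤ α)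
    (k : ℕ) (hk : k = 2 * α + 1) :
    ∃ C : ℂ, C ≠ 0 ∧
      ∀ (H : EuclideanSpace ℝ (Fin d) → ℝ), IsHomogPoly d m H →
      ∀ (p q : EuclideanSpace ℝ (Fin d) → ℂ),
        ContDiff ℝ (⊤ : ℕ∞) p → HasCompactSupport p →
        ContDiff ℝ (⊤ : ℕ∞) q → HasCompactSupport q →
        (fun u => p u - ((H u : ℝ) : ℂ) ^ k)
          =o[𝓝 (0 : EuclideanSpace ℝ (Fin d))] (fun u => ‖u‖ ^ (k * m)) →
        (fun u => q u - ((2 * α + 1 : ℝ) : ℂ) * ((H u : ℝ) : ℂ) ^ (k - 1))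
          =o[𝓝 (0 : EuclideanSpace ℝ (Fin d))] (fun u => ‖u‖ ^ ((k - 1) * m)) →
        (fun μ : ℝ =>
            Complex.I * μ * (∫ u, Complex.exp (Complex.I * μ * ‖u‖ ^ 2) * p u)
              + (∫ u, Complex.exp (Complex.I * μ * ‖u‖ ^ 2) * q u)
              - C * (((lap d)^[m * α] (fun u => H u ^ (2 * α)) 0 : ℝ) : ℂ)
                  * ((μ ^ (-(m * α : ℝ) - d / 2) : ℝ) : ℂ))
          =o[atTop] fun μ : ℝ => μ ^ (-(m * α : ℝ) - d / 2) := by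
  refine ⟨(2 * α + 1 : ℝ) * ((Real.pi * Complex.I) ^ (d / 2 : ℂ) * (Complex.I / 4) ^ (m * α)
    / (m * α).factorial), ?_, ?_⟩
  · have hπ : (Real.pi : ℂ) * Complex.I ≠ 0 :=
      mul_ne_zero (by exact_mod_cast Real.pi_ne_zero) Complex.I_ne_zero
    have h1 : ((2 * α + 1 : ℝ) : ℂ) ≠ 0 := by
      rw [Complex.ofReal_ne_zero]
      positivity
    have h2 : (Real.pi * Complex.I) ^ (d / 2 : ℂ) ≠ 0 := by simp [Complex.cpow_eq_zero_iff, hπ]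
    have h3 : ((m * α).factorial : ℂ) ≠ 0 := by exact_mod_cast (m * α).factorial_ne_zero
    have h4 : (Complex.I / 4) ^ (m * α) ≠ 0 := pow_ne_zero _ (by simp)
    exact mul_ne_zero h1 (div_ne_zero (mul_ne_zero h2 h4) h3)
  intro H hH p q hp hpc hq hqc hpH hqH
  subst hk
  rw [Nat.add_sub_cancel] at hqH
  have hmα : 0 < m * α := by positivity
  have hO : (fun μ : ℝ => Complex.I * μ * ∫ u, Complex.exp (Complex.I * μ * ‖u‖ ^ 2) * p u)
      =o[atTop] fun μ : ℝ => μ ^ (-(m * α : ℝ) - d / 2) := by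
    have hp0 : p =o[𝓝 0] fun u => ‖u‖ ^ (2 * (m * α + 1)) :=
      isLittleO_of_isLittleO_sub_pow (c := 1) (k := 2 * α + 1) hH (by nlinarith)
        (by simpa using hpH)
    have h1 := isBigO_integral_exp_mul (n := m * α + 2) (f := hpc.toSchwartzMap hp) fun j hj =>
      laplacian_iterate_apply_zero_eq_zero (N := m * α + 1) hp0 (by omega)
    have h2 : (fun μ : ℝ => Complex.I * μ) =O[atTop] fun μ : ℝ => μ :=
      IsBigO.of_bound 1 (Eventually.of_forall fun μ => by simp)
    refine (h2.mul h1).trans_isLittleO ?_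
    have h3 : (fun μ : ℝ => μ⁻¹) =o[atTop] fun _ : ℝ => (1 : ℝ) :=
      (isLittleO_one_iff ℝ).2 tendsto_inv_atTop_zero
    have h4 := (isBigO_refl (fun μ : ℝ => μ ^ (-(m * α : ℝ) - d / 2)) atTop).mul_isLittleO h3
    refine h4.congr' ?_ (by simp)
    filter_upwards [eventually_gt_atTop 0] with μ hμ
    rw [finrank_euclideanSpace_fin, ← Real.rpow_neg_one μ, ← Real.rpow_add hμ]
    nth_rewrite 2 [← Real.rpow_one μ]
    rw [← Real.rpow_add hμ]
    congr 1
    push_cast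
    ring
  have hq0 : q =o[𝓝 0] fun u => ‖u‖ ^ (2 * (m * α - 1)) :=
    isLittleO_of_isLittleO_sub_pow (k := 2 * α) hH
      (by rw [mul_assoc, mul_comm α m]; omega) hqH
  have h1 := isLittleO_integral_exp_mul_sub (n := m * α) (f := hqc.toSchwartzMap hq) fun j hj =>
    laplacian_iterate_apply_zero_eq_zero (N := m * α - 1) hq0 (by omega)
  have h2 := laplacian_iterate_apply_zero_of_isLittleO_sub (N := m * α)
    (f := hqc.toSchwartzMap hq) (g := fun u => H u ^ (2 * α)) (c := (2 * α + 1 : ℝ))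
    ((contDiff_of_isHomogPoly hH).pow _)
    (by simpa [mul_assoc, mul_comm α m] using hqH)
  rw [h2, finrank_euclideanSpace_fin, Nat.cast_mul] at h1
  refine (hO.add h1).congr_left fun μ => ?_
  rw [add_sub_assoc, ← mul_assoc, mul_comm ((2 * α + 1 : ℝ) : ℂ)]
  rfl
end
end

section
/- Let d ≥ 1 and let m ≥ 1, α ≥ 1 be integers. Let H : ℝ^d → ℝ be a homogeneous polynomial of degree m such that (Δ^{mα}(H^{2α}))(0) = 0. Then H = 0 identically. -/
noncomputable section
open Filter Asymptotics

open MeasureTheory ProbabilityTheory MvPolynomial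

section Gaussian

lemma integrable_pow_mul_gaussianPDFReal (k : ℕ) :
    Integrable fun x : ℝ => x ^ k * gaussianPDFReal 0 1 x := by
  have h := (integrable_rpow_mul_exp_neg_mul_sq (b := 1 / 2) (by norm_num) (s := k)
    (by have : (0 : ℝ) ≤ k := k.cast_nonneg
        linarith)).const_mul (Real.sqrt (2 * Real.pi * (1 : NNReal)))⁻¹
  refine h.congr (.of_forall fun x => ?_)
  simp only [gaussianPDFReal, Real.rpow_natCast, NNReal.coe_one]
  rw [show -(x - 0) ^ 2 / (2 * 1) = -(1 / 2) * x ^ 2 by ring]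
  ring

lemma integrable_pow_gaussianReal (k : ℕ) :
    Integrable (fun x : ℝ => x ^ k) (gaussianReal 0 1) := by
  have h := memLp_id_gaussianReal (μ := 0) (v := 1) (k : NNReal)
  refine (MemLp.integrable_norm_pow' (p := k) (by simpa using h)).mono' (by fun_prop) ?_
  exact .of_forall fun x => by simp

lemma hasDerivAt_gaussianPDFReal_zero_one (x : ℝ) :
    HasDerivAt (gaussianPDFReal 0 1) (-(x * gaussianPDFReal 0 1 x)) x := by
  have h : HasDerivAt (fun y : ℝ => -(y - 0) ^ 2 / (2 * ((1 : NNReal) : ℝ))) (-x) x := by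
    convert! (((hasDerivAt_id x).sub_const 0).pow 2).neg.div_const (2 * ((1 : NNReal) : ℝ)) using 1
    simp only [id, NNReal.coe_one]
    ring
  convert! h.exp.const_mul (Real.sqrt (2 * Real.pi * (1 : NNReal)))⁻¹ using 1
  simp only [gaussianPDFReal]
  ring

/-- The moment recursion of the standard Gaussian. -/
lemma integral_pow_succ_gaussianReal (k : ℕ) :
    ∫ x, x ^ (k + 1) ∂gaussianReal 0 1 = k * ∫ x, x ^ (k - 1) ∂gaussianReal 0 1 := by
  simp_rw [integral_gaussianReal_eq_integral_smul one_ne_zero, smul_eq_mul]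
  have h := integral_mul_deriv_eq_deriv_mul_of_integrable
    (u := fun x : ℝ => x ^ k) (u' := fun x => k * x ^ (k - 1))
    (fun x _ => hasDerivAt_pow k x) (fun x _ => hasDerivAt_gaussianPDFReal_zero_one x)
    ((integrable_pow_mul_gaussianPDFReal (k + 1)).neg.congr
      (.of_forall fun x => by simp only [Pi.neg_apply, Pi.mul_apply]; ring))
    (((integrable_pow_mul_gaussianPDFReal (k - 1)).const_mul (k : ℝ)).congr
      (.of_forall fun x => by simp only [Pi.mul_apply]; ring))
    (integrable_pow_mul_gaussianPDFReal k)
  calc ∫ x, gaussianPDFReal 0 1 x * x ^ (k + 1)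
      = -∫ x, x ^ k * -(x * gaussianPDFReal 0 1 x) := by
        rw [← integral_neg]
        congr with x
        ring
    _ = k * ∫ x, gaussianPDFReal 0 1 x * x ^ (k - 1) := by
        rw [h, neg_neg, ← integral_const_mul]
        congr with x
        ring

end Gaussian

section Polynomial

/-- The standard Gaussian measure on `σ → ℝ`. -/
def stdGaussianPi (σ : Type*) [Fintype σ] : Measure (σ → ℝ) :=
  Measure.pi fun _ => gaussianReal 0 1

variable {σ : Type*} [Fintype σ]

instance : (stdGaussianPi σ).IsOpenPosMeasure := by
  have : (gaussianReal 0 1).IsOpenPosMeasure :=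
    (gaussianReal_absolutelyContinuous' 0 one_ne_zero).isOpenPosMeasure
  unfold stdGaussianPi
  infer_instance

lemma eval_monomial_eq_prod (s : σ →₀ ℕ) (a : ℝ) (x : σ → ℝ) :
    eval x (monomial s a) = a * ∏ i, x i ^ s i := by
  rw [eval_monomial, Finsupp.prod_fintype _ _ (fun _ => pow_zero _)]

lemma integrable_eval_stdGaussianPi (p : MvPolynomial σ ℝ) :
    Integrable (fun x => eval x p) (stdGaussianPi σ) := by
  induction p using MvPolynomial.induction_on' with
  | monomial s a =>
    simp_rw [eval_monomial_eq_prod]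
    exact (Integrable.fintype_prod fun i => integrable_pow_gaussianReal (s i)).const_mul a
  | add p q hp hq =>
    simp only [map_add]
    exact hp.add hq

lemma integral_eval_monomial_stdGaussianPi (s : σ →₀ ℕ) (a : ℝ) :
    ∫ x, eval x (monomial s a) ∂stdGaussianPi σ =
      a * ∏ i, ∫ x, x ^ s i ∂gaussianReal 0 1 := by
  simp_rw [eval_monomial_eq_prod]
  rw [integral_const_mul, stdGaussianPi,
    integral_fintype_prod_eq_prod (fun i (y : ℝ) => y ^ s i)]

/-- Gaussian integration by parts for polynomials. -/
lemma integral_eval_X_mul_stdGaussianPi (i : σ) (p : MvPolynomial σ ℝ) :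
    ∫ x, eval x (X i * p) ∂stdGaussianPi σ = ∫ x, eval x (pderiv i p) ∂stdGaussianPi σ := by
  classical
  induction p using MvPolynomial.induction_on' with
  | monomial s a =>
    rw [pderiv_monomial, X, monomial_mul, integral_eval_monomial_stdGaussianPi,
      integral_eval_monomial_stdGaussianPi, ← Finset.mul_prod_erase _ _ (Finset.mem_univ i),
      ← Finset.mul_prod_erase _ _ (Finset.mem_univ i)]
    have h : ∀ j ∈ Finset.univ.erase i,
        (Finsupp.single i 1 + s : σ →₀ ℕ) j = (s - Finsupp.single i 1 : σ →₀ ℕ) j := by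
      intro j hj
      simp [Finsupp.single_eq_of_ne (Finset.ne_of_mem_erase hj)]
    rw [Finset.prod_congr rfl fun j hj => by rw [h j hj]]
    simp only [Finsupp.add_apply, Finsupp.tsub_apply, Finsupp.single_eq_same, add_comm 1]
    rw [integral_pow_succ_gaussianReal]
    ring
  | add p q hp hq =>
    simp only [mul_add, map_add]
    rw [integral_add (integrable_eval_stdGaussianPi _) (integrable_eval_stdGaussianPi _),
      integral_add (integrable_eval_stdGaussianPi _) (integrable_eval_stdGaussianPi _), hp, hq]

/-- The Laplacian of a multivariate polynomial. -/
def polyLaplacian (p : MvPolynomial σ ℝ) : MvPolynomial σ ℝ := ∑ i, pderiv i (pderiv i p)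

lemma MvPolynomial.IsHomogeneous.polyLaplacian {p : MvPolynomial σ ℝ} {n : ℕ}
    (hp : p.IsHomogeneous n) : (polyLaplacian p).IsHomogeneous (n - 2) :=
  IsHomogeneous.sum _ _ _ fun _ _ => hp.pderiv.pderiv

lemma integral_eval_polyLaplacian {p : MvPolynomial σ ℝ} {n : ℕ} (hp : p.IsHomogeneous n) :
    ∫ x, eval x (polyLaplacian p) ∂stdGaussianPi σ = n * ∫ x, eval x p ∂stdGaussianPi σ := by
  calc ∫ x, eval x (polyLaplacian p) ∂stdGaussianPi σ
      = ∑ i, ∫ x, eval x (pderiv i (pderiv i p)) ∂stdGaussianPi σ := by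
        simp only [polyLaplacian, map_sum]
        exact integral_finsetSum _ fun i _ => integrable_eval_stdGaussianPi _
    _ = ∑ i, ∫ x, eval x (X i * pderiv i p) ∂stdGaussianPi σ := by
        simp_rw [integral_eval_X_mul_stdGaussianPi]
    _ = ∫ x, eval x (∑ i, X i * pderiv i p) ∂stdGaussianPi σ := by
        simp only [map_sum]
        exact (integral_finsetSum _ fun i _ => integrable_eval_stdGaussianPi _).symm
    _ = n * ∫ x, eval x p ∂stdGaussianPi σ := by
        rw [hp.sum_X_mul_pderiv, ← integral_const_mul]
        simp

lemma eval_zero_iterate_polyLaplacian (s : ℕ) {p : MvPolynomial σ ℝ}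
    (hp : p.IsHomogeneous (2 * s)) :
    eval 0 (polyLaplacian^[s] p) = 2 ^ s * s.factorial * ∫ x, eval x p ∂stdGaussianPi σ := by
  induction s generalizing p with
  | zero =>
    rw [mul_zero, ← totalDegree_zero_iff_isHomogeneous, totalDegree_eq_zero_iff_eq_C] at hp
    have : IsProbabilityMeasure (stdGaussianPi σ) := by
      unfold stdGaussianPi
      infer_instance
    rw [hp]
    simp
  | succ s ih =>
    rw [Function.iterate_succ_apply, ih hp.polyLaplacian, integral_eval_polyLaplacian hp,
      Nat.factorial_succ]
    push_cast
    ring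

lemma eq_zero_of_integral_eval_pow_eq_zero {p : MvPolynomial σ ℝ} {n : ℕ} (hn : Even n)
    (h : ∫ x, eval x (p ^ n) ∂stdGaussianPi σ = 0) (x : σ → ℝ) : eval x p = 0 := by
  have h0 : 0 ≤ fun x => eval x (p ^ n) := fun x => by simpa using hn.pow_nonneg _
  rw [integral_eq_zero_iff_of_nonneg h0 (integrable_eval_stdGaussianPi _),
    (MvPolynomial.continuous_eval _).ae_eq_iff_eq _ continuous_zero] at h
  have := congrFun h x
  simp only [map_pow, Pi.zero_apply] at this
  exact eq_zero_of_pow_eq_zero this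

lemma hasFDerivAt_eval_euclidean (p : MvPolynomial σ ℝ) (x : EuclideanSpace ℝ σ) :
    HasFDerivAt (fun y : EuclideanSpace ℝ σ => eval (fun i => y i) p)
      (∑ i, eval (fun i => x i) (pderiv i p) • EuclideanSpace.proj (𝕜 := ℝ) i) x := by
  classical
  induction p using MvPolynomial.induction_on with
  | C a => simpa using hasFDerivAt_const a x
  | add p q hp hq =>
    simp only [map_add, add_smul, Finset.sum_add_distrib]
    exact hp.add hq
  | mul_X p i hp =>
    have hi : HasFDerivAt (fun y : EuclideanSpace ℝ σ => y i)
        (EuclideanSpace.proj (𝕜 := ℝ) i) x :=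
      (EuclideanSpace.proj i : EuclideanSpace ℝ σ →L[ℝ] ℝ).hasFDerivAt
    simp only [eval_mul, eval_X]
    convert! hp.mul hi using 1
    simp only [pderiv_mul, map_add, eval_mul, eval_X, add_smul, Finset.sum_add_distrib, pderiv_X,
      Finset.smul_sum, smul_smul, mul_comm (x i)]
    rw [add_comm]
    congr 1
    rw [Finset.sum_eq_single i]
    · simp
    · intro j _ hj
      simp [Pi.single_eq_of_ne hj.symm]
    · simp

end Polynomial

lemma lap_eval (d : ℕ) (p : MvPolynomial (Fin d) ℝ) :
    lap d (fun x => eval (fun i => x i) p) = fun x => eval (fun i => x i) (polyLaplacian p) := by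
  funext x
  simp only [lap, polyLaplacian, map_sum]
  refine Finset.sum_congr rfl fun i _ => ?_
  have h : fderiv ℝ (fun x : EuclideanSpace ℝ (Fin d) => eval (fun i => x i) p) = fun x =>
      ∑ i, eval (fun i => x i) (pderiv i p) • EuclideanSpace.proj (𝕜 := ℝ) i :=
    funext fun x => (hasFDerivAt_eval_euclidean p x).fderiv
  have h2 := HasFDerivAt.fun_sum (u := Finset.univ) fun j _ =>
    (hasFDerivAt_eval_euclidean (pderiv j p) x).smul_const
      (EuclideanSpace.proj j : EuclideanSpace ℝ (Fin d) →L[ℝ] ℝ)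
  rw [iteratedFDeriv_two_apply, h, h2.fderiv]
  simp [PiLp.single_apply]

lemma iterate_lap_eval (d s : ℕ) (p : MvPolynomial (Fin d) ℝ) :
    (lap d)^[s] (fun x => eval (fun i => x i) p) =
      fun x => eval (fun i => x i) (polyLaplacian^[s] p) := by
  induction s generalizing p with
  | zero => rfl
  | succ s ih => rw [Function.iterate_succ_apply, lap_eval, ih, Function.iterate_succ_apply]

/-- If `H` is a homogeneous polynomial of degree `m ≥ 1` on `ℝ^d` and
`(Δ^{mα}(H^{2α}))(0) = 0` for some `α ≥ 1`, then `H` vanishes identically. -/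
theorem statement14 (d : ℕ) (hd : 1 ≤ d) (m α : ℕ) (hm : 1 ≤ m) (hα : 1 ≤ α)
    (H : EuclideanSpace ℝ (Fin d) → ℝ) (hH : IsHomogPoly d m H)
    (hzero : (lap d)^[m * α] (fun x => H x ^ (2 * α)) 0 = 0) :
    ∀ x, H x = 0 := by
  obtain ⟨p, hp, hHp⟩ := hH
  have hpow : (p ^ (2 * α)).IsHomogeneous (2 * (m * α)) := by
    convert! hp.pow (2 * α) using 1
    ring
  have hfun : (fun x => H x ^ (2 * α)) = fun x => eval (fun i => x i) (p ^ (2 * α)) := by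
    funext x
    rw [hHp, map_pow]
  have h0 : eval 0 (polyLaplacian^[m * α] (p ^ (2 * α))) = 0 := by
    rw [hfun, iterate_lap_eval] at hzero
    exact hzero
  rw [eval_zero_iterate_polyLaplacian _ hpow] at h0
  have hint := (mul_eq_zero.mp h0).resolve_left (by positivity)
  intro x
  rw [hHp]
  exact eq_zero_of_integral_eval_pow_eq_zero (even_two_mul α) hint _
end
end

section
/- Let d ≥ 1 and r ≥ 0 be integers, and let w : ℝ^d → ℂ be a C^∞ function with compact support such that all partial derivatives of w of order < 2r vanish at 0 (equivalently, w(u) = o(‖u‖^{2r−1}) as u → 0 when r ≥ 1). Then ∫_{ℝ^d} e^{iμ‖u‖²} w(u) du = O(μ^{−d/2 − r}) as μ → +∞. -/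
noncomputable section
open MeasureTheory Filter Asymptotics
open scoped Topology
open scoped FourierTransform SchwartzMap InnerProductSpace

/-- Taylor remainder bound for the exponential on the closed left half-plane, uniform at
infinity. -/
lemma norm_exp_sub_sum_le_of_re_nonpos {z : ℂ} (hz : z.re ≤ 0) (n : ℕ) :
    ‖Complex.exp z - ∑ m ∈ Finset.range n, z ^ m / m.factorial‖ ≤
      (n + Real.exp 1) * ‖z‖ ^ n := by
  rcases le_total ‖z‖ 1 with h | h
  · refine (Complex.norm_exp_sub_sum_le_norm_mul_exp z n).trans ?_
    rw [mul_comm]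
    gcongr
    have : Real.exp ‖z‖ ≤ Real.exp 1 := Real.exp_le_exp.2 h
    linarith [n.cast_nonneg (α := ℝ)]
  · have hexp : ‖Complex.exp z‖ ≤ 1 := by
      rw [Complex.norm_exp]
      exact Real.exp_le_one_iff.2 hz
    have hsum : ‖∑ m ∈ Finset.range n, z ^ m / (m.factorial : ℂ)‖ ≤ n * ‖z‖ ^ n := by
      refine (norm_sum_le_of_le _ fun m hm ↦ ?_).trans
        (by simp : ∑ _m ∈ Finset.range n, ‖z‖ ^ n ≤ n * ‖z‖ ^ n)
      rw [norm_div, norm_pow, Complex.norm_natCast]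
      have h1 : (1 : ℝ) ≤ m.factorial := by exact_mod_cast m.factorial_pos
      exact (div_le_self (by positivity) h1).trans
        (pow_le_pow_right₀ h (Finset.mem_range.1 hm).le)
    have h1 : 1 ≤ ‖z‖ ^ n := one_le_pow₀ h
    have h2 : 1 ≤ Real.exp 1 := Real.one_le_exp zero_le_one
    calc _ ≤ 1 + n * ‖z‖ ^ n := (norm_sub_le _ _).trans (add_le_add hexp hsum)
      _ ≤ _ := by nlinarith

section InnerProductSpace

variable {V : Type*} [NormedAddCommGroup V] [InnerProductSpace ℝ V] [FiniteDimensional ℝ V]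
  [MeasurableSpace V] [BorelSpace V]

lemma integrable_norm_pow_mul (g : 𝓢(V, ℂ)) (k : ℕ) :
    Integrable fun v : V ↦ (‖v‖ : ℂ) ^ k * g v := by
  refine (g.integrable_pow_mul volume k).mono' ?_ (.of_forall fun v ↦ by simp)
  exact (by fun_prop : Continuous fun v : V ↦ (‖v‖ : ℂ) ^ k * g v).aestronglyMeasurable

/-- A moment of `g` vanishes if the corresponding derivatives of `𝓕 g` vanish at `0`. -/
lemma integral_prod_inner_mul_eq_zero (g : 𝓢(V, ℂ)) {n : ℕ}
    (h : iteratedFDeriv ℝ n (𝓕 (g : V → ℂ)) 0 = 0) (m : Fin n → V) :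
    ∫ v, (∏ i, (⟪v, m i⟫_ℝ : ℂ)) * g v = 0 := by
  have hint : Integrable fun v ↦ VectorFourier.fourierPowSMulRight (innerSL ℝ) (g : V → ℂ) v n :=
    VectorFourier.integrable_fourierPowSMulRight _ (g.integrable_pow_mul volume n)
      g.continuous.aestronglyMeasurable
  rw [Real.iteratedFDeriv_fourier (N := ⊤) (fun k _ ↦ g.integrable_pow_mul volume k)
    g.continuous.aestronglyMeasurable le_top] at h
  have h' : 𝓕 (fun v ↦ VectorFourier.fourierPowSMulRight (innerSL ℝ) (g : V → ℂ) v n m) 0 = 0 :=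
    (Real.fourier_continuousMultilinearMap_apply hint).symm.trans (congrArg (fun M ↦ M m) h)
  simp only [Real.fourier_eq, inner_zero_right, neg_zero, AddChar.map_zero_eq_one, one_smul,
    VectorFourier.fourierPowSMulRight_apply] at h'
  rw [integral_smul, smul_eq_zero] at h'
  have := h'.resolve_left (pow_ne_zero _ (by simp [Real.pi_ne_zero]))
  simpa [Complex.real_smul] using! this

lemma integral_norm_pow_mul_eq_zero (g : 𝓢(V, ℂ)) {j : ℕ}
    (h : iteratedFDeriv ℝ (j + j) (𝓕 (g : V → ℂ)) 0 = 0) :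
    ∫ v, (‖v‖ : ℂ) ^ (2 * j) * g v = 0 := by
  let e := stdOrthonormalBasis ℝ V
  let m (p : Fin j → Fin (Module.finrank ℝ V)) : Fin (j + j) → V :=
    Fin.append (e ∘ p) (e ∘ p)
  have hexpand (v : V) : (‖v‖ : ℂ) ^ (2 * j) * g v =
      ∑ p : Fin j → Fin (Module.finrank ℝ V), (∏ i, (⟪v, m p i⟫_ℝ : ℂ)) * g v := by
    have : (‖v‖ : ℂ) ^ 2 = ∑ i, (⟪v, e i⟫_ℝ : ℂ) * ⟪v, e i⟫_ℝ := by
      rw [← Complex.ofReal_pow, ← e.sum_sq_inner_left]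
      simp [sq]
    rw [pow_mul, this, Fintype.sum_pow, Finset.sum_mul]
    simp only [m, Fin.prod_univ_add, Finset.prod_mul_distrib, Fin.append_left, Fin.append_right,
      Function.comp_apply]
  simp_rw [hexpand]
  rw [integral_finsetSum]
  · exact Finset.sum_eq_zero fun p _ ↦ integral_prod_inner_mul_eq_zero g h (m p)
  · intro p _
    refine (g.integrable_pow_mul volume (j + j)).mono' ?_ (.of_forall fun v ↦ ?_)
    · exact (by fun_prop : Continuous fun v : V ↦
        (∏ i, (⟪v, m p i⟫_ℝ : ℂ)) * g v).aestronglyMeasurable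
    · rw [norm_mul, norm_prod]
      gcongr
      refine (Finset.prod_le_prod (fun _ _ ↦ norm_nonneg _) fun i _ ↦ ?_).trans
        (by simp : ∏ _i : Fin (j + j), ‖v‖ ≤ _)
      have hm : ‖m p i‖ = 1 := by
        refine Fin.addCases (fun i ↦ ?_) (fun i ↦ ?_) i <;>
          simp only [m, Fin.append_left, Fin.append_right, Function.comp_apply, e.norm_eq_one]
      simpa [hm] using norm_inner_le_norm (𝕜 := ℝ) v (m p i)

lemma integral_gaussian_mul_fourier (g : 𝓢(V, ℂ)) {b : ℂ} (hb : 0 < b.re) :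
    ∫ u, Complex.exp (-b * ‖u‖ ^ 2) * 𝓕 (g : V → ℂ) u =
      (Real.pi / b) ^ (Module.finrank ℝ V / 2 : ℂ) *
        ∫ v, Complex.exp (-Real.pi ^ 2 * ‖v‖ ^ 2 / b) * g v := by
  have hG : Integrable fun u : V ↦ Complex.exp (-b * ‖u‖ ^ 2) := by
    simpa using GaussianFourier.integrable_cexp_neg_mul_sq_norm_add hb 0 (0 : V)
  have h : ∫ v, 𝓕 (fun u : V ↦ Complex.exp (-b * ‖u‖ ^ 2)) v • g v =
      ∫ u, Complex.exp (-b * ‖u‖ ^ 2) • 𝓕 (g : V → ℂ) u := by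
    simpa using! VectorFourier.integral_fourierIntegral_smul_eq_flip (L := innerₗ V)
      Real.continuous_fourierChar continuous_inner hG g.integrable
  simp only [smul_eq_mul] at h
  rw [← h, ← integral_const_mul]
  simp_rw [fourier_gaussian_innerProductSpace hb, mul_assoc]

/-- If `𝓕 g` vanishes to order `2r` at `0`, its integral against a Gaussian of complex parameter
`b` is bounded uniformly in `b`, without loss near the imaginary axis. -/
lemma exists_norm_integral_gaussian_mul_fourier_le (g : 𝓢(V, ℂ)) (r : ℕ)
    (h : ∀ j < 2 * r, iteratedFDeriv ℝ j (𝓕 (g : V → ℂ)) 0 = 0) :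
    ∃ C : ℝ, ∀ b : ℂ, 0 < b.re →
      ‖∫ u, Complex.exp (-b * ‖u‖ ^ 2) * 𝓕 (g : V → ℂ) u‖ ≤
        C * ‖b‖ ^ (-(Module.finrank ℝ V : ℝ) / 2 - r) := by
  set d : ℝ := (Module.finrank ℝ V : ℝ)
  refine ⟨Real.pi ^ (d / 2) * ((r + Real.exp 1) * (Real.pi ^ 2) ^ r *
    ∫ v, ‖v‖ ^ (2 * r) * ‖g v‖), fun b hb ↦ ?_⟩
  have hb0 : b ≠ 0 := by rintro rfl; simp at hb
  have hbn : 0 < ‖b‖ := norm_pos_iff.2 hb0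
  let z (v : V) : ℂ := -Real.pi ^ 2 * ‖v‖ ^ 2 / b
  have hzre (v : V) : (z v).re ≤ 0 := by
    have : z v = ((-(Real.pi ^ 2 * ‖v‖ ^ 2) : ℝ) : ℂ) * b⁻¹ := by
      simp only [z]; push_cast; ring
    rw [this, Complex.re_ofReal_mul, Complex.inv_re]
    exact mul_nonpos_of_nonpos_of_nonneg (by simp only [Left.neg_nonpos_iff]; positivity)
      (div_nonneg hb.le (Complex.normSq_nonneg b))
  have hznorm (v : V) : ‖z v‖ = Real.pi ^ 2 * ‖v‖ ^ 2 / ‖b‖ := by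
    simp [z, abs_of_pos Real.pi_pos]
  have hterm (m : ℕ) (v : V) : z v ^ m / m.factorial * g v =
      ((-Real.pi ^ 2 / b) ^ m / m.factorial) * ((‖v‖ : ℂ) ^ (2 * m) * g v) := by
    simp only [z]
    rw [pow_mul, mul_div_right_comm, mul_pow]
    ring
  have hexp_int : Integrable fun v ↦ Complex.exp (z v) * g v := by
    refine g.integrable.norm.mono' ?_ (.of_forall fun v ↦ ?_)
    · exact (by fun_prop : Continuous fun v ↦ Complex.exp (z v) * g v).aestronglyMeasurable
    · rw [norm_mul, Complex.norm_exp]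
      exact mul_le_of_le_one_left (norm_nonneg _) (Real.exp_le_one_iff.2 (hzre v))
  have hterm_int (m : ℕ) : Integrable fun v ↦ z v ^ m / m.factorial * g v := by
    simp_rw [hterm]
    exact (integrable_norm_pow_mul g (2 * m)).const_mul _
  have hsum : ∫ v, ∑ m ∈ Finset.range r, z v ^ m / m.factorial * g v = 0 := by
    rw [integral_finsetSum _ fun m _ ↦ hterm_int m]
    refine Finset.sum_eq_zero fun m hm ↦ ?_
    simp_rw [hterm]
    have := Finset.mem_range.1 hm
    rw [integral_const_mul, integral_norm_pow_mul_eq_zero g (h (m + m) (by lia)), mul_zero]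
  have hbound : ‖∫ v, Complex.exp (z v) * g v‖ ≤
      (r + Real.exp 1) * (Real.pi ^ 2) ^ r * (∫ v, ‖v‖ ^ (2 * r) * ‖g v‖) * (‖b‖ ^ r)⁻¹ := by
    rw [← sub_zero (∫ v, Complex.exp (z v) * g v), ← hsum,
      ← integral_sub hexp_int (integrable_finsetSum _ fun m _ ↦ hterm_int m),
      mul_right_comm, ← integral_const_mul]
    refine norm_integral_le_of_norm_le ((g.integrable_pow_mul volume (2 * r)).const_mul _)
      (.of_forall fun v ↦ ?_)
    rw [← Finset.sum_mul, ← sub_mul, norm_mul]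
    calc _ ≤ (r + Real.exp 1) * ‖z v‖ ^ r * ‖g v‖ := by
          gcongr
          exact norm_exp_sub_sum_le_of_re_nonpos (hzre v) r
      _ = _ := by
          rw [hznorm, div_pow, mul_pow, pow_mul]
          ring
  have hpre : ‖((Real.pi : ℂ) / b) ^ (Module.finrank ℝ V / 2 : ℂ)‖ =
      Real.pi ^ (d / 2) * ‖b‖ ^ (-d / 2) := by
    have : (Module.finrank ℝ V / 2 : ℂ) = ((d / 2 : ℝ) : ℂ) := by simp [d]
    rw [this, Complex.norm_cpow_real, norm_div, Complex.norm_of_nonneg Real.pi_pos.le,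
      Real.div_rpow Real.pi_pos.le hbn.le, neg_div, Real.rpow_neg hbn.le, div_eq_mul_inv]
  rw [integral_gaussian_mul_fourier g hb, norm_mul, hpre, Real.rpow_sub hbn, Real.rpow_natCast]
  exact (mul_le_mul_of_nonneg_left hbound (by positivity)).trans_eq (by ring)

/-- The integral of an integrable function against a Gaussian is continuous up to the imaginary
axis. -/
lemma tendsto_integral_gaussian_mul {w : V → ℂ} (hw : Integrable w) (a : ℂ) (ha : 0 ≤ a.re) :
    Tendsto (fun ε : ℝ ↦ ∫ u, Complex.exp (-(a + ε) * ‖u‖ ^ 2) * w u) (𝓝[>] 0)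
      (𝓝 (∫ u, Complex.exp (-a * ‖u‖ ^ 2) * w u)) := by
  refine tendsto_integral_filter_of_dominated_convergence (fun u ↦ ‖w u‖) ?_ ?_ hw.norm ?_
  · refine .of_forall fun ε ↦ AEStronglyMeasurable.mul ?_ hw.aestronglyMeasurable
    exact (by fun_prop : Continuous fun u : V ↦
      Complex.exp (-(a + ε) * ‖u‖ ^ 2)).aestronglyMeasurable
  · filter_upwards [self_mem_nhdsWithin] with ε (hε : 0 < ε)
    refine .of_forall fun u ↦ ?_
    rw [norm_mul, Complex.norm_exp]
    refine mul_le_of_le_one_left (norm_nonneg _) (Real.exp_le_one_iff.2 ?_)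
    rw [← Complex.ofReal_pow, Complex.re_mul_ofReal]
    refine mul_nonpos_of_nonpos_of_nonneg ?_ (by positivity)
    simp only [Complex.neg_re, Complex.add_re, Complex.ofReal_re]
    linarith
  · refine .of_forall fun u ↦ Tendsto.mono_left ?_ nhdsWithin_le_nhds
    have : Continuous fun ε : ℝ ↦ Complex.exp (-(a + ε) * ‖u‖ ^ 2) * w u := by fun_prop
    simpa using this.tendsto 0

end InnerProductSpace

/-- If `w : ℝ^d → ℂ` is `C^∞` with compact support and all partial
derivatives of `w` of order `< 2r` vanish at `0`, then
`∫_{ℝ^d} e^{iμ‖u‖²} w(u) du = O(μ^{-d/2-r})` as `μ → +∞`. -/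
theorem statement19 (d : ℕ) (hd : 1 ≤ d) (r : ℕ)
    (w : EuclideanSpace ℝ (Fin d) → ℂ)
    (hw_sm : ContDiff ℝ (⊤ : ℕ∞) w) (hw_supp : HasCompactSupport w)
    (hw_van : ∀ j < 2 * r, iteratedFDeriv ℝ j w 0 = 0) :
    (fun μ : ℝ => ∫ u, Complex.exp (Complex.I * μ * ‖u‖ ^ 2) * w u)
      =O[atTop] fun μ : ℝ => μ ^ (-(d : ℝ) / 2 - r) := by
  let W : 𝓢(EuclideanSpace ℝ (Fin d), ℂ) := hw_supp.toSchwartzMap hw_sm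
  have hW : 𝓕 ((𝓕⁻ W : 𝓢(EuclideanSpace ℝ (Fin d), ℂ)) : EuclideanSpace ℝ (Fin d) → ℂ) = w := by
    rw [← SchwartzMap.fourier_coe, FourierTransform.fourier_fourierInv_eq]
    rfl
  obtain ⟨C, hC⟩ := exists_norm_integral_gaussian_mul_fourier_le (𝓕⁻ W) r (by rwa [hW])
  rw [hW, finrank_euclideanSpace_fin] at hC
  refine IsBigO.of_bound C ?_
  filter_upwards [eventually_gt_atTop 0] with μ hμ
  have hlim := tendsto_integral_gaussian_mul (w := w) W.integrable (-(Complex.I * μ)) (by simp)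
  simp only [neg_neg] at hlim
  have hnorm : Tendsto (fun ε : ℝ ↦ C * ‖-(Complex.I * μ) + (ε : ℂ)‖ ^ (-(d : ℝ) / 2 - r))
      (𝓝[>] 0) (𝓝 (C * ‖μ ^ (-(d : ℝ) / 2 - r)‖)) := by
    refine Tendsto.mono_left ?_ nhdsWithin_le_nhds
    have hc : Continuous fun ε : ℝ ↦ ‖-(Complex.I * μ) + (ε : ℂ)‖ := by fun_prop
    have h0 := hc.tendsto 0
    simp only [Complex.ofReal_zero, add_zero, norm_neg, norm_mul, Complex.norm_I, one_mul,
      Complex.norm_of_nonneg hμ.le] at h0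
    rw [Real.norm_of_nonneg (by positivity)]
    exact (h0.rpow_const (.inl hμ.ne')).const_mul C
  refine le_of_tendsto_of_tendsto hlim.norm hnorm ?_
  filter_upwards [self_mem_nhdsWithin] with ε (hε : 0 < ε)
  exact hC _ (by simpa using hε)
end
end
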